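/- Let D be a positive integer. Let f : ℂ → ℂ satisfy f(ζ) = C_f e^{αζ} ∏_{j=1}^∞ (1 + γ_j ζ) with C_f > 0, α ≥ 0, and (γ_j) a summable sequence of nonnegative reals, and let g : [0,∞) → ℝ be positive and differentiable with derivative g'(s) = C_g e^{βs} ∏_{j=1}^∞ (1 + δ_j s) for s ≥ 0, where C_g > 0, β ≥ 0, (δ_j) summable nonnegative, and not all of β, δ_j are zero (equivalently, if g is a polynomial, its degree is at least two). Assume ∫_{ℝ^D} e^{a|σ|²} f(|σ|²) e^{−g(|σ|²)} dσ < ∞ for every a > 0. Then there exist C > 0 and a summable sequence (λ_j) of nonnegative reals such that ∫_{ℝ^D} e^{z·σ} f(|σ|²) e^{−g(|σ|²)} dσ = C ∏_{j=1}^∞ (1 + λ_j z²) for all z ∈ ℂ^D. -/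

import Mathlib

open MeasureTheory Complex

noncomputable section

/-- Complex bilinear dot product `z · w = Σ_j z_j w_j` (no conjugation). -/
def cdot {D : ℕ} (z w : Fin D → ℂ) : ℂ := ∑ j, z j * w j

/-- Real scalar product. -/
def rdot {D : ℕ} (x y : Fin D → ℝ) : ℝ := ∑ j, x j * y j

/-- Pairing `z · σ = Σ_j z_j σ_j` of a complex vector with a real vector. -/
def cpair {D : ℕ} (z : Fin D → ℂ) (σ : Fin D → ℝ) : ℂ := ∑ j, z j * (σ j : ℂ)

namespace LeeYang

open Polynomial Filter Topology Set

/-- Nonzero real polynomials with nonnegative coefficients and without zeros in the open upper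
half-plane; equivalently, all their complex zeros are real and nonpositive. -/
structure NegRooted (p : ℝ[X]) : Prop where
  coeff_nonneg : ∀ k, 0 ≤ p.coeff k
  aeval_ne_zero : ∀ w : ℂ, 0 < w.im → aeval w p ≠ 0

theorem aeval_conj_real (p : ℝ[X]) (w : ℂ) :
    aeval ((starRingEnd ℂ) w) p = (starRingEnd ℂ) (aeval w p) := by
  have := Polynomial.aeval_algHom_apply (Complex.conjAe : ℂ →ₐ[ℝ] ℂ) w p
  simpa using this

theorem NegRooted.ne_zero {p : ℝ[X]} (hp : NegRooted p) : p ≠ 0 := by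
  rintro rfl
  exact hp.aeval_ne_zero Complex.I (by simp) (by simp)

theorem NegRooted.eval_pos {p : ℝ[X]} (hp : NegRooted p) {x : ℝ} (hx : 0 < x) :
    0 < p.eval x := by
  rw [eval_eq_sum_range]
  refine Finset.sum_pos' (fun k _ => mul_nonneg (hp.coeff_nonneg k) (pow_nonneg hx.le k))
    ⟨p.natDegree, by simp, ?_⟩
  refine mul_pos (lt_of_le_of_ne (hp.coeff_nonneg _) ?_) (pow_pos hx _)
  exact fun h => hp.ne_zero (leadingCoeff_eq_zero.1 h.symm)

theorem NegRooted.exists_of_root {p : ℝ[X]} (hp : NegRooted p) {ρ : ℂ} (h : aeval ρ p = 0) :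
    ∃ r : ℝ, 0 ≤ r ∧ ρ = -(r : ℂ) := by
  have him : ρ.im = 0 := by
    rcases lt_trichotomy ρ.im 0 with h' | h' | h'
    · refine absurd ?_ (hp.aeval_ne_zero ((starRingEnd ℂ) ρ) (by simpa using h'))
      rw [aeval_conj_real, h, map_zero]
    · exact h'
    · exact absurd h (hp.aeval_ne_zero ρ h')
  have hρ : ρ = ((ρ.re : ℝ) : ℂ) := by
    apply Complex.ext <;> simp [him]
  refine ⟨-ρ.re, ?_, by rw [hρ]; simp⟩
  by_contra! hneg
  have hpos := hp.eval_pos (x := ρ.re) (by linarith)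
  rw [hρ] at h
  have h2 : ((p.eval ρ.re : ℝ) : ℂ) = 0 := by
    rw [← h]
    simpa using (Polynomial.aeval_algebraMap_apply ℂ ρ.re p).symm
  exact hpos.ne' (by exact_mod_cast h2)

theorem sum_inv_im (w : ℂ) (hw : 0 < w.im) (s : Multiset ℂ)
    (hs : ∀ ρ ∈ s, ∃ r : ℝ, 0 ≤ r ∧ ρ = -(r : ℂ)) :
    (s = 0 ∨ ((s.map fun ρ => 1 / (w - ρ)).sum).im < 0) ∧
      0 ≤ (w * (s.map fun ρ => 1 / (w - ρ)).sum).im := by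
  induction s using Multiset.induction with
  | empty => simp
  | cons ρ s ih =>
    obtain ⟨h1, h2⟩ := ih fun ρ' h => hs ρ' (Multiset.mem_cons_of_mem h)
    obtain ⟨r, hr, rfl⟩ := hs ρ (Multiset.mem_cons_self ρ s)
    have hne : w - -(r : ℂ) ≠ 0 := by
      intro h
      have := congrArg Complex.im h
      simp at this
      exact hw.ne' this
    have hn : 0 < Complex.normSq (w - -(r : ℂ)) := Complex.normSq_pos.2 hne
    have e1 : (1 / (w - -(r : ℂ))).im < 0 := by
      rw [one_div, Complex.inv_im]
      apply div_neg_of_neg_of_pos _ hn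
      simpa using hw
    have e2 : 0 ≤ (w * (1 / (w - -(r : ℂ)))).im := by
      have : w * (1 / (w - -(r : ℂ))) = 1 - r * (1 / (w - -(r : ℂ))) := by
        field_simp
        ring
      rw [this, Complex.sub_im, Complex.im_ofReal_mul, Complex.one_im]
      nlinarith
    simp only [Multiset.map_cons, Multiset.sum_cons, mul_add, Complex.add_im]
    refine ⟨Or.inr ?_, add_nonneg e2 h2⟩
    rcases h1 with rfl | h1
    · simpa using e1
    · exact add_neg e1 h1

theorem NegRooted.logDeriv_im {p : ℝ[X]} (hp : NegRooted p) {w : ℂ} (hw : 0 < w.im) :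
    (derivative p = 0 ∨ (aeval w (derivative p) / aeval w p).im < 0) ∧
      0 ≤ (w * (aeval w (derivative p) / aeval w p)).im := by
  have hne : (p.map (algebraMap ℝ ℂ)).eval w ≠ 0 := by
    rw [eval_map_algebraMap]; exact hp.aeval_ne_zero w hw
  have key := (IsAlgClosed.splits (p.map (algebraMap ℝ ℂ))).eval_derivative_div_eval_of_ne_zero hne
  rw [derivative_map, eval_map_algebraMap, eval_map_algebraMap] at key
  obtain ⟨h1, h2⟩ := sum_inv_im w hw (p.map (algebraMap ℝ ℂ)).roots (by
    intro ρ hρ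
    refine hp.exists_of_root ?_
    rw [← eval_map_algebraMap]
    exact (mem_roots'.1 hρ).2)
  rw [key]
  refine ⟨h1.imp_left fun h => ?_, h2⟩
  have hc := (IsAlgClosed.splits (p.map (algebraMap ℝ ℂ))).natDegree_eq_card_roots
  rw [h, Multiset.card_zero, natDegree_map] at hc
  rw [eq_C_of_natDegree_eq_zero hc, derivative_C]

theorem NegRooted.derivative {p : ℝ[X]} (hp : NegRooted p) :
    derivative p = 0 ∨ NegRooted (derivative p) := by
  by_cases h0 : Polynomial.derivative p = 0
  · exact Or.inl h0
  refine Or.inr ⟨fun k => ?_, fun w hw h => ?_⟩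
  · rw [coeff_derivative]
    exact mul_nonneg (hp.coeff_nonneg _) (by positivity)
  · have := (hp.logDeriv_im hw).1.resolve_left h0
    simp [h] at this

/-- The radial part of the `d`-dimensional Laplacian in the variable `w = z²`. -/
def radialLaplacian (d : ℕ) (p : ℝ[X]) : ℝ[X] :=
  C 4 * X * derivative (derivative p) + C (2 * d : ℝ) * derivative p

theorem coeff_radialLaplacian (d : ℕ) (p : ℝ[X]) (k : ℕ) :
    (radialLaplacian d p).coeff k = 2 * (k + 1) * (2 * k + d) * p.coeff (k + 1) := by
  rw [radialLaplacian, coeff_add, mul_assoc, coeff_C_mul, coeff_C_mul]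
  cases k with
  | zero => simp [coeff_derivative]
  | succ k =>
    rw [coeff_X_mul, coeff_derivative, coeff_derivative]
    push_cast
    ring

theorem NegRooted.add_radialLaplacian {p : ℝ[X]} (hp : NegRooted p) (d : ℕ)
    {c : ℝ} (hc : 0 ≤ c) : NegRooted (p + C c * radialLaplacian d p) := by
  refine ⟨fun k => ?_, fun w hw h => ?_⟩
  · rw [coeff_add, coeff_C_mul, coeff_radialLaplacian]
    have := hp.coeff_nonneg k
    have := hp.coeff_nonneg (k + 1)
    positivity
  · by_cases h0 : Polynomial.derivative p = 0
    · refine hp.aeval_ne_zero w hw ?_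
      simpa [radialLaplacian, h0] using h
    have hS := (hp.logDeriv_im hw).1.resolve_left h0
    have hp' := hp.derivative.resolve_left h0
    have hT := (hp'.logDeriv_im hw).2
    have hP0 := hp.aeval_ne_zero w hw
    have hP1 := hp'.aeval_ne_zero w hw
    set P := aeval w p
    set P' := aeval w (Polynomial.derivative p)
    set P'' := aeval w (Polynomial.derivative (Polynomial.derivative p))
    have h' : P + c * (4 * w * P'' + 2 * d * P') = 0 := by
      simpa [radialLaplacian, aeval_C] using h
    have hS' : 0 < ((P' / P)⁻¹).im := by
      rw [Complex.inv_im]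
      refine div_pos (by linarith) (Complex.normSq_pos.2 (div_ne_zero hP1 hP0))
    have e : (P' / P)⁻¹ = -(c * (4 * (w * (P'' / P')) + 2 * d)) := by
      rw [inv_div]
      have : P = -(c * (4 * w * P'' + 2 * d * P')) := by linear_combination h'
      rw [this]
      field_simp
    have e2 : (c * (4 * (w * (P'' / P')) + 2 * d) : ℂ).im = c * (4 * (w * (P'' / P')).im) := by
      rw [Complex.im_ofReal_mul, Complex.add_im]
      have : ((4 : ℂ) * (w * (P'' / P'))).im = 4 * (w * (P'' / P')).im := by
        have := Complex.im_ofReal_mul 4 (w * (P'' / P'))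
        exact_mod_cast this
      rw [this]
      simp
    rw [e, Complex.neg_im, e2] at hS'
    nlinarith [mul_nonneg hc hT]

theorem NegRooted.laguerre_step {p : ℝ[X]} (hp : NegRooted p) {a c : ℝ} (ha : 0 ≤ a)
    (hc : 0 < c) :
    NegRooted (C 2 * (X * Polynomial.derivative p) + C a * p + C c * (X * p)) := by
  refine ⟨fun k => ?_, fun w hw h => ?_⟩
  · have h1 : ∀ k, 0 ≤ (X * Polynomial.derivative p).coeff k := by
      rintro (_ | k)
      · simp
      · rw [coeff_X_mul, coeff_derivative]
        exact mul_nonneg (hp.coeff_nonneg _) (by positivity)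
    have h2 : ∀ k, 0 ≤ (X * p).coeff k := by
      rintro (_ | k)
      · simp
      · rw [coeff_X_mul]; exact hp.coeff_nonneg _
    simp only [coeff_add, coeff_C_mul]
    have := h1 k
    have := h2 k
    have := hp.coeff_nonneg k
    positivity
  · have hT := (hp.logDeriv_im hw).2
    have hP0 := hp.aeval_ne_zero w hw
    set P := aeval w p
    set P' := aeval w (Polynomial.derivative p)
    have h' : 2 * (w * P') + a * P + c * (w * P) = 0 := by
      simpa [aeval_C] using h
    have e : ((2 : ℝ) : ℂ) * (w * (P' / P)) + a + c * w = 0 := by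
      push_cast
      field_simp
      linear_combination h'
    have := congrArg Complex.im e
    rw [Complex.add_im, Complex.add_im, Complex.im_ofReal_mul, Complex.im_ofReal_mul] at this
    simp only [Complex.ofReal_im, Complex.zero_im] at this
    nlinarith [mul_pos hc hw]

theorem NegRooted.C_mul {p : ℝ[X]} (hp : NegRooted p) {c : ℝ} (hc : 0 < c) :
    NegRooted (C c * p) := by
  refine ⟨fun k => ?_, fun w hw h => ?_⟩
  · rw [coeff_C_mul]; exact mul_nonneg hc.le (hp.coeff_nonneg k)
  · rw [map_mul, aeval_C] at h
    rcases mul_eq_zero.1 h with h | h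
    · simp [hc.ne'] at h
    · exact hp.aeval_ne_zero w hw h

theorem prod_map_eq_prod_range (l : List ℝ) (f : ℝ → ℂ) :
    (l.map f).prod = ∏ i ∈ Finset.range l.length, f (l.getD i 0) := by
  rw [Finset.prod_range]
  simp

theorem exists_list_of_roots (s : Multiset ℂ) (hs : ∀ ρ ∈ s, ∃ r : ℝ, 0 < r ∧ ρ = -(r : ℂ)) :
    ∃ m : Multiset ℝ, (∀ x ∈ m, 0 ≤ x) ∧ (s.map fun ρ => 1 / (0 - ρ)).sum = ((m.sum : ℝ) : ℂ) ∧
      ∀ w : ℂ, (s.map fun ρ => w - ρ).prod =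
        (s.map fun ρ => 0 - ρ).prod * (m.map fun x : ℝ => 1 + (x : ℂ) * w).prod := by
  induction s using Multiset.induction with
  | empty => exact ⟨0, by simp⟩
  | cons ρ s ih =>
    obtain ⟨m, h1, h2, h3⟩ := ih fun ρ' h => hs ρ' (Multiset.mem_cons_of_mem h)
    obtain ⟨r, hr, rfl⟩ := hs ρ (Multiset.mem_cons_self ρ s)
    have hr' : (r : ℂ) ≠ 0 := by exact_mod_cast hr.ne'
    refine ⟨r⁻¹ ::ₘ m, ?_, ?_, fun w => ?_⟩
    · intro x hx
      rcases Multiset.mem_cons.1 hx with rfl | hx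
      · positivity
      · exact h1 x hx
    · rw [Multiset.map_cons, Multiset.sum_cons, Multiset.sum_cons, h2]
      simp [one_div]
    · rw [Multiset.map_cons, Multiset.map_cons, Multiset.map_cons, Multiset.prod_cons,
        Multiset.prod_cons, Multiset.prod_cons, h3 w]
      have : w - -(r : ℂ) = (0 - -(r : ℂ)) * (1 + ((r⁻¹ : ℝ) : ℂ) * w) := by
        push_cast
        field_simp
        ring
      rw [this]
      ring

theorem NegRooted.exists_factors {p : ℝ[X]} (hp : NegRooted p) (h0 : 0 < p.coeff 0) :
    ∃ (lam : ℕ → ℝ) (N : ℕ), (∀ j, 0 ≤ lam j) ∧ (∀ j, N ≤ j → lam j = 0) ∧ Antitone lam ∧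
      p.coeff 1 / p.coeff 0 = ∑ j ∈ Finset.range N, lam j ∧
      ∀ w : ℂ, aeval w p = p.coeff 0 * ∏ j ∈ Finset.range N, (1 + (lam j : ℂ) * w) := by
  have hz : aeval (0 : ℂ) p = (p.coeff 0 : ℂ) := by
    simp [Polynomial.aeval_def, eval₂_at_zero]
  have hz0 : (p.coeff 0 : ℂ) ≠ 0 := by exact_mod_cast h0.ne'
  have hspl := IsAlgClosed.splits (p.map (algebraMap ℝ ℂ))
  obtain ⟨m, hm, hsum, hprod⟩ := exists_list_of_roots (p.map (algebraMap ℝ ℂ)).roots (by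
    intro ρ hρ
    have hρ' : aeval ρ p = 0 := by
      rw [← eval_map_algebraMap]
      exact (mem_roots'.1 hρ).2
    obtain ⟨r, hr, rfl⟩ := hp.exists_of_root hρ'
    refine ⟨r, lt_of_le_of_ne hr ?_, rfl⟩
    rintro rfl
    simp only [ofReal_zero, neg_zero] at hρ'
    exact hz0 (hz ▸ hρ'))
  set l := m.sort (· ≥ ·) with hl
  have hlm : (l : Multiset ℝ) = m := Multiset.sort_eq m _
  have hlp : l.Pairwise (· ≥ ·) := Multiset.pairwise_sort m _
  have hpos : ∀ j, 0 ≤ l.getD j 0 := by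
    intro j
    by_cases hj : j < l.length
    · rw [List.getD_eq_getElem _ _ hj]
      exact hm _ (by rw [← hlm]; exact Multiset.mem_coe.2 (List.getElem_mem hj))
    · rw [List.getD_eq_default _ _ (by omega)]
  refine ⟨fun j => l.getD j 0, l.length, hpos, fun j hj => List.getD_eq_default _ _ hj, ?_, ?_, ?_⟩
  · intro i j hij
    rcases hij.eq_or_lt with rfl | hij
    · exact le_rfl
    by_cases hj : j < l.length
    · have := List.pairwise_iff_getElem.1 hlp i j (hij.trans hj) hj hij
      change l.getD j 0 ≤ l.getD i 0
      rwa [List.getD_eq_getElem _ _ hj, List.getD_eq_getElem _ _ (hij.trans hj)]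
    · exact (List.getD_eq_default l 0 (not_lt.1 hj)).trans_le (hpos i)
  · have h1 := hspl.eval_derivative_div_eval_of_ne_zero (x := 0)
      (by rw [eval_map_algebraMap, hz]; exact hz0)
    rw [hsum, derivative_map, eval_map_algebraMap, eval_map_algebraMap, hz] at h1
    have h2 : aeval (0 : ℂ) (Polynomial.derivative p) = (p.coeff 1 : ℂ) := by
      simp [Polynomial.aeval_def, eval₂_at_zero, coeff_derivative]
    rw [h2] at h1
    have h3 : p.coeff 1 / p.coeff 0 = m.sum := by exact_mod_cast h1
    rw [h3, ← hlm, Multiset.sum_coe, Finset.sum_range]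
    simp
  · intro w
    have h1 := hspl.eval_eq_prod_roots w
    have h2 := hspl.eval_eq_prod_roots 0
    rw [hprod w, ← mul_assoc, ← h2, eval_map_algebraMap, eval_map_algebraMap, hz] at h1
    rw [h1, ← hlm, Multiset.map_coe, Multiset.prod_coe,
      prod_map_eq_prod_range l fun x : ℝ => 1 + (x : ℂ) * w]

theorem norm_canonicalFactor_sub_one_le (u : ℂ) :
    ‖(1 + u) * Complex.exp (-u) - 1‖ ≤ 2 * ‖u‖ ^ 2 * Real.exp ‖u‖ := by
  have h1 := Complex.norm_exp_sub_sum_le_norm_mul_exp (-u) 1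
  have h2 := Complex.norm_exp_sub_sum_le_norm_mul_exp (-u) 2
  simp [Finset.sum_range_succ] at h1 h2
  have e : (1 + u) * Complex.exp (-u) - 1 =
      (Complex.exp (-u) - (1 + -u)) + u * (Complex.exp (-u) - 1) := by ring
  rw [e]
  refine (norm_add_le _ _).trans ?_
  rw [norm_mul]
  nlinarith [mul_le_mul_of_nonneg_left h1 (norm_nonneg u)]

/-- Coefficient sequences of the zero polynomial and of real polynomials all of whose zeros are
nonpositive. -/
def negRootedCoeffs : Set (ℕ → ℝ) :=
  {a | ∃ p : ℝ[X], (p = 0 ∨ NegRooted p) ∧ ∀ k, a k = p.coeff k}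

theorem antitone_le_sum_div {lam : ℕ → ℝ} {N : ℕ} (h0 : ∀ j, 0 ≤ lam j)
    (hN : ∀ j, N ≤ j → lam j = 0) (ha : Antitone lam) (J : ℕ) :
    ∑ j ∈ Finset.range J, lam j ≤ ∑ j ∈ Finset.range N, lam j ∧
      lam J ≤ (∑ j ∈ Finset.range N, lam j) / (J + 1) := by
  have h1 : ∀ J, ∑ j ∈ Finset.range J, lam j ≤ ∑ j ∈ Finset.range N, lam j := by
    intro J
    rcases le_total J N with h | h
    · exact Finset.sum_le_sum_of_subset_of_nonneg (Finset.range_mono h) fun j _ _ => h0 j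
    · refine le_of_eq (Finset.sum_subset (Finset.range_mono h) fun j _ hj => hN j ?_).symm
      simpa using hj
  refine ⟨h1 J, ?_⟩
  rw [le_div_iff₀ (by positivity)]
  refine le_trans ?_ (h1 (J + 1))
  calc lam J * (J + 1) = ∑ j ∈ Finset.range (J + 1), lam J := by simp [mul_comm]
    _ ≤ _ := Finset.sum_le_sum fun j hj => ha (by simp at hj; omega)

theorem aeval_eq_exp_mul_tprod {p : ℝ[X]} {lam : ℕ → ℝ} {N : ℕ} (hN : ∀ j, N ≤ j → lam j = 0)
    {w : ℂ} (hw : aeval w p = p.coeff 0 * ∏ j ∈ Finset.range N, (1 + (lam j : ℂ) * w)) :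
    aeval w p = p.coeff 0 * (Complex.exp (((∑ j ∈ Finset.range N, lam j : ℝ) : ℂ) * w) *
      ∏' j, (1 + ((1 + (lam j : ℂ) * w) * Complex.exp (-((lam j : ℂ) * w)) - 1))) := by
  rw [hw, tprod_eq_prod (s := Finset.range N)]
  · have : ∀ j, (1 + ((1 + (lam j : ℂ) * w) * Complex.exp (-((lam j : ℂ) * w)) - 1)) =
        (1 + (lam j : ℂ) * w) * Complex.exp (-((lam j : ℂ) * w)) := fun j => by ring
    simp_rw [this]
    rw [Finset.prod_mul_distrib, ← Complex.exp_sum, mul_left_comm (Complex.exp _),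
      ← Complex.exp_add]
    push_cast
    rw [Finset.sum_neg_distrib, Finset.sum_mul, add_neg_cancel, Complex.exp_zero, mul_one]
  · intro j hj
    rw [hN j (by simpa using hj)]
    simp

theorem norm_coeff_mul_pow_le {p : ℝ[X]} (hp : NegRooted p) {lam : ℕ → ℝ} {N : ℕ}
    (h0 : ∀ j, 0 ≤ lam j)
    (hw : ∀ w : ℂ, aeval w p = p.coeff 0 * ∏ j ∈ Finset.range N, (1 + (lam j : ℂ) * w))
    {x : ℝ} (hx : 0 ≤ x) (k : ℕ) :
    p.coeff k * x ^ k ≤ p.coeff 0 * Real.exp ((∑ j ∈ Finset.range N, lam j) * x) := by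
  have h1 : p.eval x = p.coeff 0 * ∏ j ∈ Finset.range N, (1 + lam j * x) := by
    have h := hw x
    have h2 : aeval (x : ℂ) p = ((p.eval x : ℝ) : ℂ) := by
      simpa using Polynomial.aeval_algebraMap_apply ℂ x p
    rw [h2] at h
    exact_mod_cast h
  have h2 : p.coeff k * x ^ k ≤ p.eval x := by
    by_cases hk : k ≤ p.natDegree
    · rw [eval_eq_sum_range]
      exact Finset.single_le_sum (f := fun k => p.coeff k * x ^ k)
        (fun i _ => mul_nonneg (hp.coeff_nonneg i) (pow_nonneg hx i)) (by simp; omega)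
    · rw [coeff_eq_zero_of_natDegree_lt (by omega), zero_mul, eval_eq_sum_range]
      exact Finset.sum_nonneg fun i _ => mul_nonneg (hp.coeff_nonneg i) (pow_nonneg hx i)
  refine h2.trans ?_
  rw [h1, Finset.sum_mul, Real.exp_sum]
  refine mul_le_mul_of_nonneg_left ?_ (hp.coeff_nonneg 0)
  refine Finset.prod_le_prod (fun j _ => ?_) fun j _ => ?_
  · have := mul_nonneg (h0 j) hx
    linarith
  · rw [add_comm]
    exact Real.add_one_le_exp _

/-- A coefficientwise limit of polynomials with nonpositive zeros, nonvanishing at the origin, is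
an entire function of the form `C e^{bw} ∏ (1 + λ_j w)`. -/
theorem hasSum_of_mem_closure {a : ℕ → ℝ} (ha : a ∈ closure negRootedCoeffs) (h0 : 0 < a 0) :
    ∃ (b : ℝ) (lam : ℕ → ℝ), 0 ≤ b ∧ (∀ j, 0 ≤ lam j) ∧ Summable lam ∧
      ∀ w : ℂ, HasSum (fun k => (a k : ℂ) * w ^ k)
        (a 0 * (Complex.exp (b * w) * ∏' j, (1 + (lam j : ℂ) * w))) := by
  obtain ⟨x, hxK, hxa⟩ := mem_closure_iff_seq_limit.1 ha
  rw [tendsto_pi_nhds] at hxa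
  choose p hp hpx using hxK
  have hxa' : ∀ k, Tendsto (fun n => (p n).coeff k) atTop (𝓝 (a k)) := fun k =>
    (hxa k).congr fun n => hpx n k
  set A : ℝ := a 0 + 1
  set B : ℝ := a 1 / a 0 + 1
  have ev1 : ∀ᶠ n in atTop, 0 < (p n).coeff 0 ∧ (p n).coeff 0 ≤ A ∧
      (p n).coeff 1 / (p n).coeff 0 ≤ B :=
    ((hxa' 0).eventually (lt_mem_nhds h0)).and
      (((hxa' 0).eventually (ge_mem_nhds (by simp [A]))).and
        (((hxa' 1).div (hxa' 0) h0.ne').eventually (ge_mem_nhds (by simp [B]))))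
  obtain ⟨n0, hn0⟩ := eventually_atTop.1 ev1
  have hneg : ∀ n, NegRooted (p (n + n0)) := by
    intro n
    refine (hp (n + n0)).resolve_left fun h => ?_
    have := (hn0 (n + n0) (by omega)).1
    simp [h] at this
  choose lam N hlam hN hanti hS hfac using fun n =>
    (hneg n).exists_factors (hn0 (n + n0) (by omega)).1
  have hB0 : 0 ≤ B := by
    refine le_trans ?_ (hn0 (0 + n0) (by omega)).2.2
    rw [hS 0]
    exact Finset.sum_nonneg fun j _ => hlam 0 j
  have hlamB : ∀ n j, lam n j ≤ B / (j + 1) := fun n j => by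
    refine (antitone_le_sum_div (hlam n) (hN n) (hanti n) j).2.trans ?_
    rw [← hS n]
    have := (hn0 (n + n0) (by omega)).2.2
    gcongr
  obtain ⟨L, hLmem, φ, hφ, hLφ⟩ := (isCompact_univ_pi
    (X := fun _ : ℕ => ℝ) (s := fun j : ℕ => Icc 0 (B / ((j : ℝ) + 1)))
    (fun j => isCompact_Icc)).tendsto_subseq (x := lam)
    (fun n j _ => ⟨hlam n j, hlamB n j⟩)
  rw [tendsto_pi_nhds] at hLφ
  have hL0 : ∀ j, 0 ≤ L j := fun j => (hLmem j (mem_univ j)).1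
  set ψ : ℕ → ℕ := fun n => φ n + n0
  have hψ : Tendsto ψ atTop atTop := 
    tendsto_atTop_mono (fun n => Nat.le_add_right _ _) hφ.tendsto_atTop
  have hpψ : ∀ k, Tendsto (fun n => (p (ψ n)).coeff k) atTop (𝓝 (a k)) := fun k =>
    (hxa' k).comp hψ
  have hSlim : Tendsto (fun n => ∑ j ∈ Finset.range (N (φ n)), lam (φ n) j) atTop
      (𝓝 (a 1 / a 0)) := by
    refine ((hpψ 1).div (hpψ 0) h0.ne').congr fun n => ?_
    exact hS (φ n)
  have hpart : ∀ J, ∑ j ∈ Finset.range J, L j ≤ a 1 / a 0 := by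
    intro J
    refine le_of_tendsto_of_tendsto (tendsto_finsetSum (Finset.range J) fun j _ => hLφ j) hSlim
      (Eventually.of_forall fun n => ?_)
    exact (antitone_le_sum_div (hlam _) (hN _) (hanti _) J).1
  have hLs : Summable L := summable_of_sum_range_le hL0 hpart
  have hLt : ∑' j, L j ≤ a 1 / a 0 := hLs.tsum_le_of_sum_range_le hpart
  refine ⟨a 1 / a 0 - ∑' j, L j, L, by linarith, hL0, hLs, fun w => ?_⟩
  have hLw : Summable fun j => ‖(L j : ℂ) * w‖ := by
    simp_rw [norm_mul, Complex.norm_real, Real.norm_of_nonneg (hL0 _)]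
    exact hLs.mul_right _
  have hLw' : Summable fun j => -((L j : ℂ) * w) := hLw.of_norm.neg
  -- the limit of the values
  have hval : Tendsto (fun n => aeval w (p (ψ n))) atTop
      (𝓝 (a 0 * (Complex.exp (((a 1 / a 0 : ℝ) : ℂ) * w) *
        ∏' j, (1 + ((1 + (L j : ℂ) * w) * Complex.exp (-((L j : ℂ) * w)) - 1))))) := by
    have hbd : Summable fun j : ℕ =>
        2 * (B * ‖w‖ / ((j : ℝ) + 1)) ^ 2 * Real.exp (B * ‖w‖) := by
      have h := (summable_nat_add_iff (f := fun j : ℕ => 1 / (j : ℝ) ^ 2) 1).2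
        (Real.summable_one_div_nat_pow.2 (one_lt_two))
      refine (h.mul_left (2 * (B * ‖w‖) ^ 2 * Real.exp (B * ‖w‖))).congr fun j => ?_
      push_cast
      field_simp
    have hprod := tendsto_tprod_one_add_of_dominated_convergence (𝓕 := atTop)
      (f := fun n j => (1 + (lam (φ n) j : ℂ) * w) * Complex.exp (-((lam (φ n) j : ℂ) * w)) - 1)
      (g := fun j => (1 + (L j : ℂ) * w) * Complex.exp (-((L j : ℂ) * w)) - 1) hbd
      (fun j => by
        have hc : Continuous fun t : ℝ =>
          (1 + (t : ℂ) * w) * Complex.exp (-((t : ℂ) * w)) - 1 := by fun_prop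
        exact (hc.tendsto (L j)).comp (hLφ j))
      (Eventually.of_forall fun n j => by
        refine (norm_canonicalFactor_sub_one_le _).trans ?_
        have h1 : ‖(lam (φ n) j : ℂ) * w‖ ≤ B * ‖w‖ / ((j : ℝ) + 1) := by
          rw [norm_mul, Complex.norm_real, Real.norm_of_nonneg (hlam _ _), mul_div_right_comm]
          exact mul_le_mul_of_nonneg_right (hlamB _ _) (norm_nonneg _)
        have h2 : B * ‖w‖ / ((j : ℝ) + 1) ≤ B * ‖w‖ :=
          div_le_self (by positivity) (by linarith [(Nat.cast_nonneg j : (0 : ℝ) ≤ j)])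
        gcongr
        exact h1.trans h2)
    have hexp : Tendsto (fun n => Complex.exp
        (((∑ j ∈ Finset.range (N (φ n)), lam (φ n) j : ℝ) : ℂ) * w)) atTop
        (𝓝 (Complex.exp (((a 1 / a 0 : ℝ) : ℂ) * w))) := by
      have hc : Continuous fun t : ℝ => Complex.exp ((t : ℂ) * w) := by fun_prop
      exact (hc.tendsto _).comp hSlim
    have hz : Tendsto (fun n => ((p (ψ n)).coeff 0 : ℂ)) atTop (𝓝 (a 0 : ℂ)) :=
      (Complex.continuous_ofReal.tendsto _).comp (hpψ 0)
    refine (hz.mul (hexp.mul hprod)).congr fun n => ?_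
    exact (aeval_eq_exp_mul_tprod (hN (φ n)) (hfac (φ n) w)).symm
  -- the limit of the sums
  set Y : ℝ := 2 * ‖w‖ + 1
  have hY : 0 < Y := by positivity
  have hbdg : Summable fun k : ℕ => A * Real.exp (B * Y) * (1 / 2 : ℝ) ^ k :=
    summable_geometric_two.mul_left _
  have hbound : ∀ n k, ‖((p (ψ n)).coeff k : ℂ) * w ^ k‖ ≤
      A * Real.exp (B * Y) * (1 / 2 : ℝ) ^ k := by
    intro n k
    have h1 := norm_coeff_mul_pow_le (hneg (φ n)) (hlam (φ n)) (hfac (φ n)) hY.le k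
    rw [← hS] at h1
    obtain ⟨h2, h3, h4⟩ := hn0 (φ n + n0) (by omega)
    have h5 : (p (φ n + n0)).coeff k * Y ^ k ≤ A * Real.exp (B * Y) := by
      refine h1.trans ?_
      gcongr
    rw [norm_mul, norm_pow, Complex.norm_real,
      Real.norm_of_nonneg ((hneg (φ n)).coeff_nonneg k)]
    have h6 : ‖w‖ ≤ Y * (1 / 2) := by simp only [Y]; linarith
    calc _ ≤ (p (φ n + n0)).coeff k * (Y * (1 / 2)) ^ k := by
          refine mul_le_mul_of_nonneg_left ?_ ((hneg (φ n)).coeff_nonneg k)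
          gcongr
      _ = (p (φ n + n0)).coeff k * Y ^ k * (1 / 2) ^ k := by rw [mul_pow]; ring
      _ ≤ _ := by gcongr
  have hak : ∀ k, Tendsto (fun n => ((p (ψ n)).coeff k : ℂ) * w ^ k) atTop
      (𝓝 ((a k : ℂ) * w ^ k)) := fun k =>
    ((Complex.continuous_ofReal.tendsto _).comp (hpψ k)).mul_const _
  have hsumm : Summable fun k => (a k : ℂ) * w ^ k :=
    Summable.of_norm_bounded hbdg fun k =>
      le_of_tendsto (hak k).norm (Eventually.of_forall fun n => hbound n k)
  have hts := tendsto_tsum_of_dominated_convergence hbdg hak (Eventually.of_forall hbound)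
  have hts' : Tendsto (fun n => aeval w (p (ψ n))) atTop (𝓝 (∑' k, (a k : ℂ) * w ^ k)) := by
    refine hts.congr fun n => ?_
    rw [aeval_eq_sum_range, tsum_eq_sum (s := Finset.range ((p (ψ n)).natDegree + 1))]
    · simp
    · intro k hk
      rw [coeff_eq_zero_of_natDegree_lt (by simpa using hk)]
      simp
  have hfin := tendsto_nhds_unique hts' hval
  have hprodeq : ∏' j, (1 + ((1 + (L j : ℂ) * w) * Complex.exp (-((L j : ℂ) * w)) - 1)) =
      (∏' j, (1 + (L j : ℂ) * w)) * Complex.exp (-(((∑' j, L j : ℝ) : ℂ) * w)) := by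
    have h1 : ∀ j, (1 + ((1 + (L j : ℂ) * w) * Complex.exp (-((L j : ℂ) * w)) - 1)) =
        (1 + (L j : ℂ) * w) * Complex.exp (-((L j : ℂ) * w)) := fun j => by ring
    simp_rw [h1]
    have h2 : HasProd (fun j => Complex.exp (-((L j : ℂ) * w))) _ := hLw'.hasSum.cexp
    rw [Multipliable.tprod_mul (multipliable_one_add_of_summable hLw) h2.multipliable]
    congr 1
    refine h2.tprod_eq.trans ?_
    rw [tsum_neg, tsum_mul_right, Complex.ofReal_tsum]
  have := hsumm.hasSum
  rw [hfin, hprodeq] at this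
  convert this using 2
  rw [mul_left_comm (Complex.exp _), ← Complex.exp_add, mul_comm]
  congr 2
  push_cast
  ring

theorem add_radialLaplacian_mem_closure (d : ℕ) {a : ℕ → ℝ} (ha : a ∈ closure negRootedCoeffs)
    {c : ℝ} (hc : 0 ≤ c) :
    (fun k : ℕ => a k + c * (2 * (k + 1) * (2 * k + d) * a (k + 1))) ∈
      closure negRootedCoeffs := by
  refine map_mem_closure (f := fun (a : ℕ → ℝ) (k : ℕ) =>
    a k + c * (2 * (k + 1) * (2 * k + d) * a (k + 1))) (by fun_prop) ha ?_
  rintro a ⟨p, hp, hpa⟩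
  refine ⟨p + C c * radialLaplacian d p, ?_, fun k => ?_⟩
  · rcases hp with rfl | hp
    · left; simp [radialLaplacian]
    · exact Or.inr (hp.add_radialLaplacian d hc)
  · simp only [coeff_add, coeff_C_mul, coeff_radialLaplacian, hpa]

theorem derivative_mem_closure {a : ℕ → ℝ} (ha : a ∈ closure negRootedCoeffs) :
    (fun k : ℕ => ((k : ℝ) + 1) * a (k + 1)) ∈ closure negRootedCoeffs := by
  refine map_mem_closure (f := fun (a : ℕ → ℝ) (k : ℕ) => ((k : ℝ) + 1) * a (k + 1))
    (by fun_prop) ha ?_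
  rintro a ⟨p, hp, hpa⟩
  refine ⟨derivative p, ?_, fun k => ?_⟩
  · rcases hp with rfl | hp
    · left; simp
    · exact hp.derivative
  · simp only [coeff_derivative, hpa, mul_comm]

theorem const_mul_mem_closure {a : ℕ → ℝ} (ha : a ∈ closure negRootedCoeffs)
    {c : ℝ} (hc : 0 ≤ c) : (fun k : ℕ => c * a k) ∈ closure negRootedCoeffs := by
  refine map_mem_closure (f := fun (a : ℕ → ℝ) (k : ℕ) => c * a k) (by fun_prop) ha ?_
  rintro a ⟨p, hp, hpa⟩
  refine ⟨C c * p, ?_, fun k => by simp only [coeff_C_mul, hpa]⟩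
  rcases hp with rfl | hp
  · left; simp
  · rcases hc.eq_or_lt with rfl | hc
    · left; simp
    · exact Or.inr (hp.C_mul hc)

/-- Generalized Laguerre polynomials, up to normalization and the sign of the argument. -/
theorem exists_laguerre (d : ℕ) {c : ℝ} (hc : 0 < c) (n : ℕ) :
    ∃ p : ℝ[X], NegRooted p ∧ ∀ k, p.coeff k =
      n.choose k * c ^ k * (∏ i ∈ Finset.range k, (1 / (2 * i + d + 2 : ℝ))) *
        ∏ i ∈ Finset.range n, (2 * i + d + 2 : ℝ) := by
  induction n with
  | zero =>
    refine ⟨1, ⟨fun k => ?_, fun w _ => by simp⟩, fun k => ?_⟩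
    · rw [coeff_one]; split_ifs <;> simp
    · rcases k with _ | k
      · simp
      · simp [coeff_one]
  | succ n ih =>
    obtain ⟨p, hp, hpc⟩ := ih
    refine ⟨_, hp.laguerre_step (a := 2 * n + d + 2) (by positivity) hc, fun k => ?_⟩
    rcases k with _ | k
    · simp only [coeff_add, mul_coeff_zero, coeff_X_zero, hpc,
        Finset.prod_range_succ]
      simp
      ring
    · simp only [coeff_add, coeff_C_mul, coeff_X_mul, hpc, coeff_derivative,
        Finset.prod_range_succ, pow_succ]
      have h1 : ((n + 1).choose (k + 1) : ℝ) = n.choose k + n.choose (k + 1) := by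
        exact_mod_cast Nat.choose_succ_succ n k
      have h2 : (n.choose (k + 1) : ℝ) * (k + 1) = n.choose k * (n - k) := by
        rcases le_or_gt k n with h | h
        · have := Nat.choose_succ_right_eq n k
          rw [← Nat.cast_sub h]
          exact_mod_cast this
        · rw [Nat.choose_eq_zero_of_lt h, Nat.choose_eq_zero_of_lt (by omega)]
          simp
      rw [h1]
      have h3 : (2 * k + d + 2 : ℝ) ≠ 0 := by positivity
      field_simp
      linear_combination 2 * h2

theorem bessel_mem_closure (d : ℕ) {c : ℝ} (hc : 0 < c) :
    (fun k : ℕ => (c / 2) ^ k / k.factorial *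
      ∏ i ∈ Finset.range k, (1 / (2 * i + d + 2 : ℝ))) ∈ closure negRootedCoeffs := by
  choose p hp hpc using fun n : ℕ =>
    exists_laguerre d (c := c / (2 * ((n : ℝ) + 1))) (by positivity) (n + 1)
  refine mem_closure_of_tendsto (b := atTop) (f := fun (n : ℕ) (k : ℕ) =>
    (∏ i ∈ Finset.range (n + 1), (2 * i + d + 2 : ℝ))⁻¹ * (p n).coeff k) ?_
    (Eventually.of_forall fun n => ⟨_, Or.inr ((hp n).C_mul (c :=
      (∏ i ∈ Finset.range (n + 1), (2 * i + d + 2 : ℝ))⁻¹) ?_), fun k => by rw [coeff_C_mul]⟩)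
  · rw [tendsto_pi_nhds]
    intro k
    have h0 : Tendsto (fun n : ℕ => (n : ℝ) * (c / (2 * n))) atTop (𝓝 (c / 2)) := by
      refine tendsto_const_nhds.congr' ?_
      filter_upwards [eventually_gt_atTop 0] with n hn
      field_simp
    have h1 := ((ProbabilityTheory.tendsto_choose_mul_pow_atTop k h0).comp
      (tendsto_add_atTop_nat 1)).mul_const (∏ i ∈ Finset.range k, (1 / (2 * i + d + 2 : ℝ)))
    refine h1.congr fun n => ?_
    rw [hpc]
    have h3 : (∏ i ∈ Finset.range (n + 1), (2 * i + d + 2 : ℝ)) ≠ 0 :=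
      Finset.prod_ne_zero_iff.2 fun i _ => by positivity
    rw [mul_comm _ (∏ i ∈ Finset.range (n + 1), _), inv_mul_cancel_left₀ h3]
    simp
  · exact inv_pos.2 (Finset.prod_pos fun i _ => by positivity)

/-- The ratio between the `k`-th Taylor coefficient (in `w = z²`) of the Laplace transform of a
radial measure on `ℝ^(m+1)` and its `k`-th even moment, up to a constant. -/
def radialWeight (m k : ℕ) : ℝ :=
  ∏ i ∈ Finset.range k, (1 / (2 * (i + 1) * (2 * i + (m + 1))) : ℝ)

theorem radialWeight_pos (m k : ℕ) : 0 < radialWeight m k :=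
  Finset.prod_pos fun i _ => by positivity

theorem radialWeight_succ (m k : ℕ) :
    radialWeight m (k + 1) * (2 * (k + 1) * (2 * k + (m + 1))) = radialWeight m k := by
  rw [radialWeight, Finset.prod_range_succ, ← radialWeight]
  field_simp

/-- The Taylor coefficients in `w = z²`, up to a constant, of the Laplace transform of
`h(|σ|²) dσ` on the ball of radius `R` in `ℝ^(m+1)`. -/
def ballCoeff (m : ℕ) (R : ℝ) (h : ℝ → ℝ) (k : ℕ) : ℝ :=
  radialWeight m k * ∫ r in (0 : ℝ)..R, r ^ (2 * k + m) * h (r ^ 2)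

theorem ballCoeff_one_add_mul_mem {m : ℕ} {R : ℝ} {h : ℝ → ℝ} (hh : Continuous h)
    (hm : ballCoeff m R h ∈ closure negRootedCoeffs) {c : ℝ} (hc : 0 ≤ c) :
    ballCoeff m R (fun s => (1 + c * s) * h s) ∈ closure negRootedCoeffs := by
  convert add_radialLaplacian_mem_closure (m + 1) hm hc using 1
  ext k
  have e : ∫ r in (0 : ℝ)..R, r ^ (2 * k + m) * ((1 + c * r ^ 2) * h (r ^ 2)) =
      (∫ r in (0 : ℝ)..R, r ^ (2 * k + m) * h (r ^ 2)) +
        c * ∫ r in (0 : ℝ)..R, r ^ (2 * (k + 1) + m) * h (r ^ 2) := by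
    rw [← intervalIntegral.integral_const_mul, ← intervalIntegral.integral_add]
    · congr 1; ext r; ring
    · exact Continuous.intervalIntegrable (by fun_prop) _ _
    · exact Continuous.intervalIntegrable (by fun_prop) _ _
  rw [ballCoeff, e, ballCoeff, ballCoeff, ← radialWeight_succ]
  push_cast
  ring

theorem ballCoeff_const_mul_mem {m : ℕ} {R : ℝ} {h : ℝ → ℝ}
    (hm : ballCoeff m R h ∈ closure negRootedCoeffs) {c : ℝ} (hc : 0 ≤ c) :
    ballCoeff m R (fun s => c * h s) ∈ closure negRootedCoeffs := by
  convert const_mul_mem_closure hm hc using 1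
  ext k
  have e : ∫ r in (0 : ℝ)..R, r ^ (2 * k + m) * (c * h (r ^ 2)) =
      c * ∫ r in (0 : ℝ)..R, r ^ (2 * k + m) * h (r ^ 2) := by
    rw [← intervalIntegral.integral_const_mul]
    congr 1; ext r; ring
  rw [ballCoeff, e, ballCoeff]
  ring

theorem ballCoeff_prod_mul_mem {m : ℕ} {R : ℝ} {h : ℝ → ℝ} (hh : Continuous h)
    (hm : ballCoeff m R h ∈ closure negRootedCoeffs) {c : ℕ → ℝ} (hc : ∀ j, 0 ≤ c j) (n : ℕ) :
    ballCoeff m R (fun s => (∏ j ∈ Finset.range n, (1 + c j * s)) * h s) ∈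
      closure negRootedCoeffs := by
  induction n with
  | zero => simpa using hm
  | succ n ih =>
    convert ballCoeff_one_add_mul_mem (by fun_prop) ih (hc n) using 2
    ext s
    rw [Finset.prod_range_succ]
    ring

theorem ballCoeff_pow_mul_mem {m : ℕ} {R : ℝ} {h : ℝ → ℝ} (hh : Continuous h)
    (hm : ballCoeff m R h ∈ closure negRootedCoeffs) {c : ℝ} (hc : 0 ≤ c) (n : ℕ) :
    ballCoeff m R (fun s => (1 + c * s) ^ n * h s) ∈ closure negRootedCoeffs := by
  simpa using ballCoeff_prod_mul_mem hh hm (c := fun _ => c) (fun _ => hc) n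

theorem ballCoeff_one_mem (m : ℕ) {R : ℝ} (hR : 0 < R) :
    ballCoeff m R (fun _ => 1) ∈ closure negRootedCoeffs := by
  convert const_mul_mem_closure (bessel_mem_closure (m + 1) (pow_pos hR 2))
    (c := R ^ (m + 1) / (m + 1)) (by positivity) using 1
  ext k
  have key : ∀ k : ℕ, radialWeight m k * (m + 1) = 1 / (2 ^ k * k.factorial) *
      (∏ i ∈ Finset.range k, (1 / (2 * i + (m + 1 : ℕ) + 2 : ℝ))) * (2 * k + (m + 1)) := by
    intro k
    induction k with
    | zero => simp [radialWeight]
    | succ k ih =>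
      rw [← radialWeight_succ] at ih
      rw [Finset.prod_range_succ, Nat.factorial_succ]
      push_cast at ih ⊢
      generalize ∏ i ∈ Finset.range k, (1 / (2 * (i : ℝ) + (m + 1) + 2)) = P at ih ⊢
      have h0 : (2 * (k : ℝ) + (m + 1)) ≠ 0 := by positivity
      have ih' : radialWeight m (k + 1) * (2 * (k + 1)) * (m + 1) =
          1 / (2 ^ k * k.factorial) * P :=
        mul_right_cancel₀ h0 (by linear_combination ih)
      have h1 : (2 * (k : ℝ) + (m + 1) + 2) ≠ 0 := by positivity
      field_simp at ih' ⊢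
      linear_combination (2 * (k : ℝ) + m + 3) * ih'
  have h1 : ∫ r in (0 : ℝ)..R, r ^ (2 * k + m) * (1 : ℝ) =
      R ^ (2 * k + m + 1) / (2 * k + (m + 1)) := by
    simp [integral_pow]
    ring
  have h2 := key k
  have h3 : radialWeight m k = 1 / (2 ^ k * k.factorial) *
      (∏ i ∈ Finset.range k, (1 / (2 * i + (m + 1 : ℕ) + 2 : ℝ))) * (2 * k + (m + 1)) /
        (m + 1) := by
    rw [← key k]; field_simp
  rw [ballCoeff, h1, h3, div_pow]
  field_simp
  ring

theorem ballCoeff_sub_pow_succ_mem {m : ℕ} {R : ℝ} {p G : ℝ → ℝ} {c : ℝ} (hp : Continuous p)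
    (hG : ∀ s, HasDerivAt G (p s) s) (hc : G (R ^ 2) = c) (n : ℕ)
    (hm : ballCoeff m R (fun s => p s * (c - G s) ^ n) ∈ closure negRootedCoeffs) :
    ballCoeff m R (fun s => (c - G s) ^ (n + 1)) ∈ closure negRootedCoeffs := by
  convert const_mul_mem_closure (derivative_mem_closure hm) (c := 4 * (n + 1)) (by positivity)
    using 1
  ext k
  have hGc : Continuous G := continuous_iff_continuousAt.2 fun s => (hG s).continuousAt
  have hu : ∀ r : ℝ, HasDerivAt (fun r => (c - G (r ^ 2)) ^ (n + 1))
      ((n + 1 : ℕ) * (c - G (r ^ 2)) ^ n * (-(p (r ^ 2) * (2 * r)))) r := by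
    intro r
    have h1 : HasDerivAt (fun r : ℝ => r ^ 2) (2 * r) r := by simpa using hasDerivAt_pow 2 r
    have h2 := ((hG (r ^ 2)).comp r h1).const_sub c
    simpa using h2.fun_pow (n + 1)
  have hv : ∀ r : ℝ, HasDerivAt (fun r : ℝ => r ^ (2 * k + m + 1) / (2 * k + m + 1 : ℝ))
      (r ^ (2 * k + m)) r := by
    intro r
    have h1 := (hasDerivAt_pow (2 * k + m + 1) r).div_const (2 * k + m + 1 : ℝ)
    refine h1.congr_deriv ?_
    push_cast
    field_simp
  have hparts := intervalIntegral.integral_mul_deriv_eq_deriv_mul (a := 0) (b := R)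
    (fun r _ => hu r) (fun r _ => hv r) (Continuous.intervalIntegrable (by fun_prop) _ _)
    (Continuous.intervalIntegrable (by fun_prop) _ _)
  have e1 : ∫ r in (0 : ℝ)..R, r ^ (2 * k + m) * (c - G (r ^ 2)) ^ (n + 1) =
      (2 * (n + 1) / (2 * k + m + 1 : ℝ)) *
        ∫ r in (0 : ℝ)..R, r ^ (2 * (k + 1) + m) * (p (r ^ 2) * (c - G (r ^ 2)) ^ n) := by
    rw [← intervalIntegral.integral_const_mul]
    simp only [mul_comm (_ ^ (2 * k + m)) ((_ : ℝ) ^ (n + 1))]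
    rw [hparts, hc, sub_self, zero_pow n.succ_ne_zero, zero_pow (2 * k + m).succ_ne_zero, zero_div,
      mul_zero, zero_mul, sub_zero, zero_sub, ← intervalIntegral.integral_neg]
    congr 1
    ext r
    push_cast
    ring
  rw [ballCoeff, e1, ballCoeff, ← radialWeight_succ]
  field_simp
  ring

theorem ballCoeff_mul_sub_pow_mem {m : ℕ} {R : ℝ} (hR : 0 < R) {p q G : ℝ → ℝ} {c : ℝ}
    (hp : Continuous p)
    (hpm : ∀ h : ℝ → ℝ, Continuous h → ballCoeff m R h ∈ closure negRootedCoeffs →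
      ballCoeff m R (fun s => p s * h s) ∈ closure negRootedCoeffs)
    (hqm : ∀ h : ℝ → ℝ, Continuous h → ballCoeff m R h ∈ closure negRootedCoeffs →
      ballCoeff m R (fun s => q s * h s) ∈ closure negRootedCoeffs)
    (hG : ∀ s, HasDerivAt G (p s) s) (hc : G (R ^ 2) = c) (n : ℕ) :
    ballCoeff m R (fun s => q s * (c - G s) ^ n) ∈ closure negRootedCoeffs := by
  have hGc : Continuous G := continuous_iff_continuousAt.2 fun s => (hG s).continuousAt
  refine hqm _ (by fun_prop) ?_
  induction n with
  | zero => simpa using ballCoeff_one_mem m hR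
  | succ n ih => exact ballCoeff_sub_pow_succ_mem hp hG hc n (hpm _ (by fun_prop) ih)

/-- A Laguerre entire function of the first kind, restricted to the real line. -/
def laguerreFun (K a : ℝ) (c : ℕ → ℝ) (s : ℝ) : ℝ :=
  K * Real.exp (a * s) * ∏' j, (1 + c j * s)

/-- Polynomials with nonpositive zeros approximating `laguerreFun K a c`. -/
def laguerreApprox (K a : ℝ) (c : ℕ → ℝ) (n : ℕ) (s : ℝ) : ℝ :=
  K * ((1 + a / n * s) ^ n * ∏ j ∈ Finset.range n, (1 + c j * s))

theorem continuous_laguerreApprox (K a : ℝ) (c : ℕ → ℝ) (n : ℕ) :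
    Continuous (laguerreApprox K a c n) := by
  unfold laguerreApprox
  fun_prop

theorem ballCoeff_laguerreApprox_mul_mem {K a : ℝ} {c : ℕ → ℝ} (hK : 0 ≤ K) (ha : 0 ≤ a)
    (hc : ∀ j, 0 ≤ c j) (n : ℕ) {m : ℕ} {R : ℝ} {h : ℝ → ℝ} (hh : Continuous h)
    (hm : ballCoeff m R h ∈ closure negRootedCoeffs) :
    ballCoeff m R (fun s => laguerreApprox K a c n s * h s) ∈ closure negRootedCoeffs := by
  have h1 := ballCoeff_pow_mul_mem (by fun_prop) (ballCoeff_prod_mul_mem hh hm hc n)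
    (c := a / n) (by positivity) n
  convert ballCoeff_const_mul_mem h1 hK using 2
  ext s
  rw [laguerreApprox]
  ring

theorem tendsto_laguerreApprox (K a : ℝ) {c : ℕ → ℝ} (hc : Summable c) (s : ℝ) :
    Tendsto (fun n => laguerreApprox K a c n s) atTop (𝓝 (laguerreFun K a c s)) := by
  have h1 : Tendsto (fun n : ℕ => (1 + a / n * s) ^ n) atTop (𝓝 (Real.exp (a * s))) := by
    refine (Real.tendsto_one_add_div_pow_exp (a * s)).congr fun n => ?_
    rw [div_mul_eq_mul_div]
  have h2 : Multipliable fun j => 1 + c j * s :=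
    multipliable_one_add_of_summable ((hc.mul_right s).norm)
  have h3 := (h1.mul h2.hasProd.tendsto_prod_nat).const_mul K
  rwa [← mul_assoc] at h3

theorem one_add_sum_le_prod {c : ℕ → ℝ} (hc : ∀ j, 0 ≤ c j) (n : ℕ) :
    1 + ∑ j ∈ Finset.range n, c j ≤ ∏ j ∈ Finset.range n, (1 + c j) := by
  induction n with
  | zero => simp
  | succ n ih =>
    rw [Finset.sum_range_succ, Finset.prod_range_succ]
    have := Finset.sum_nonneg fun j (_ : j ∈ Finset.range n) => hc j
    nlinarith [hc n]

theorem le_laguerreApprox {K a : ℝ} {c : ℕ → ℝ} (hK : 0 ≤ K) (ha : 0 ≤ a)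
    (hc : ∀ j, 0 ≤ c j) {n : ℕ} (hn : 0 < n) {s : ℝ} (hs : 0 ≤ s) :
    K * (1 + (a + ∑ j ∈ Finset.range n, c j) * s) ≤ laguerreApprox K a c n s := by
  refine mul_le_mul_of_nonneg_left ?_ hK
  have h1 : 1 + a * s ≤ (1 + a / n * s) ^ n := by
    have := one_add_mul_le_pow (a := a / n * s) (by
      have : 0 ≤ a / n * s := by positivity
      linarith) n
    refine le_trans (le_of_eq ?_) this
    field_simp
  have h2 := one_add_sum_le_prod (c := fun j => c j * s) (fun j => mul_nonneg (hc j) hs) n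
  rw [← Finset.sum_mul] at h2
  have h3 := Finset.sum_nonneg fun j (_ : j ∈ Finset.range n) => hc j
  calc _ ≤ (1 + a * s) * (1 + (∑ j ∈ Finset.range n, c j) * s) := by
        nlinarith [mul_nonneg (mul_nonneg ha hs) (mul_nonneg h3 hs)]
    _ ≤ _ := mul_le_mul h1 h2 (by positivity) (by positivity)

theorem laguerreApprox_pos {K a : ℝ} {c : ℕ → ℝ} (hK : 0 < K) (ha : 0 ≤ a)
    (hc : ∀ j, 0 ≤ c j) (n : ℕ) {s : ℝ} (hs : 0 ≤ s) : 0 < laguerreApprox K a c n s := by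
  refine mul_pos hK (mul_pos (by positivity) (Finset.prod_pos fun j _ => ?_))
  have := mul_nonneg (hc j) hs
  linarith

theorem laguerreApprox_le {K a : ℝ} {c : ℕ → ℝ} (hK : 0 ≤ K) (ha : 0 ≤ a)
    (hc : ∀ j, 0 ≤ c j) (hcs : Summable c) (n : ℕ) {s : ℝ} (hs : 0 ≤ s) :
    laguerreApprox K a c n s ≤ K * Real.exp ((a + ∑' j, c j) * s) := by
  refine mul_le_mul_of_nonneg_left ?_ hK
  rw [add_mul, Real.exp_add]
  refine mul_le_mul ?_ ?_ (Finset.prod_nonneg fun j _ => ?_) (Real.exp_pos _).le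
  · rcases Nat.eq_zero_or_pos n with rfl | hn
    · simpa using mul_nonneg ha hs
    · have h1 : 1 + a / n * s ≤ Real.exp (a / n * s) := by
        linarith [Real.add_one_le_exp (a / n * s)]
      refine (pow_le_pow_left₀ (by positivity) h1 n).trans (le_of_eq ?_)
      rw [← Real.exp_nat_mul]
      congr 1
      field_simp
  · calc ∏ j ∈ Finset.range n, (1 + c j * s) ≤ ∏ j ∈ Finset.range n, Real.exp (c j * s) := by
          refine Finset.prod_le_prod (fun j _ => ?_) fun j _ => ?_
          · have := mul_nonneg (hc j) hs
            linarith
          · linarith [Real.add_one_le_exp (c j * s)]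
      _ = Real.exp ((∑ j ∈ Finset.range n, c j) * s) := by rw [← Real.exp_sum, Finset.sum_mul]
      _ ≤ _ := by
          gcongr
          exact hcs.sum_le_tsum _ fun j _ => hc j
  · have := mul_nonneg (hc j) hs
    linarith

theorem le_laguerreFun {K a : ℝ} {c : ℕ → ℝ} (hK : 0 ≤ K) (ha : 0 ≤ a)
    (hc : ∀ j, 0 ≤ c j) (hcs : Summable c) {s : ℝ} (hs : 0 ≤ s) : K ≤ laguerreFun K a c s := by
  refine ge_of_tendsto (tendsto_laguerreApprox K a hcs s) ?_
  filter_upwards [eventually_gt_atTop 0] with n hn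
  refine le_trans ?_ (le_laguerreApprox hK ha hc hn hs)
  have h3 := Finset.sum_nonneg fun j (_ : j ∈ Finset.range n) => hc j
  have : 0 ≤ K * ((a + ∑ j ∈ Finset.range n, c j) * s) := by positivity
  linarith

theorem exists_mul_le_laguerreApprox {K a : ℝ} {c : ℕ → ℝ} (hK : 0 < K) (ha : 0 ≤ a)
    (hc : ∀ j, 0 ≤ c j) (hac : a ≠ 0 ∨ ∃ j, c j ≠ 0) :
    ∃ b > 0, ∀ᶠ n in atTop, ∀ s, 0 ≤ s → b * s ≤ laguerreApprox K a c n s := by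
  obtain ⟨b, hb, N, hN⟩ : ∃ b > 0, ∃ N, ∀ n ≥ N, b ≤ a + ∑ j ∈ Finset.range n, c j := by
    rcases hac with h | ⟨j, hj⟩
    · refine ⟨a, lt_of_le_of_ne ha h.symm, 0, fun n _ => ?_⟩
      have := Finset.sum_nonneg fun j (_ : j ∈ Finset.range n) => hc j
      linarith
    · refine ⟨c j, lt_of_le_of_ne (hc j) hj.symm, j + 1, fun n hn => ?_⟩
      have := Finset.single_le_sum (fun j _ => hc j) (Finset.mem_range.2 hn)
      linarith
  refine ⟨K * b, by positivity, ?_⟩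
  filter_upwards [eventually_gt_atTop 0, eventually_ge_atTop N] with n hn hn' s hs
  refine le_trans ?_ (le_laguerreApprox hK.le ha hc hn hs)
  rw [mul_assoc]
  gcongr
  have := mul_le_mul_of_nonneg_right (hN n hn') hs
  linarith

/-- The primitive of `laguerreApprox K a c n` vanishing at the origin. -/
def laguerrePrimitive (K a : ℝ) (c : ℕ → ℝ) (n : ℕ) (s : ℝ) : ℝ :=
  ∫ t in (0 : ℝ)..s, laguerreApprox K a c n t

theorem hasDerivAt_laguerrePrimitive (K a : ℝ) (c : ℕ → ℝ) (n : ℕ) (s : ℝ) :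
    HasDerivAt (laguerrePrimitive K a c n) (laguerreApprox K a c n s) s :=
  (continuous_laguerreApprox K a c n).integral_hasStrictDerivAt 0 s |>.hasDerivAt

theorem continuous_laguerrePrimitive (K a : ℝ) (c : ℕ → ℝ) (n : ℕ) :
    Continuous (laguerrePrimitive K a c n) :=
  continuous_iff_continuousAt.2 fun s => (hasDerivAt_laguerrePrimitive K a c n s).continuousAt

theorem monotoneOn_laguerrePrimitive {K a : ℝ} {c : ℕ → ℝ} (hK : 0 < K) (ha : 0 ≤ a)
    (hc : ∀ j, 0 ≤ c j) (n : ℕ) : MonotoneOn (laguerrePrimitive K a c n) (Ici 0) := by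
  refine monotoneOn_of_deriv_nonneg (convex_Ici 0)
    (continuous_laguerrePrimitive K a c n).continuousOn
    (fun s _ => (hasDerivAt_laguerrePrimitive K a c n s).differentiableAt.differentiableWithinAt)
    fun s hs => ?_
  rw [(hasDerivAt_laguerrePrimitive K a c n s).deriv]
  rw [interior_Ici] at hs
  exact (laguerreApprox_pos hK ha hc n (le_of_lt hs)).le

theorem mul_sq_le_laguerrePrimitive {K a b : ℝ} {c : ℕ → ℝ} {n : ℕ}
    (h : ∀ s, 0 ≤ s → b * s ≤ laguerreApprox K a c n s) {s : ℝ} (hs : 0 ≤ s) :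
    b / 2 * s ^ 2 ≤ laguerrePrimitive K a c n s := by
  have h1 : ∫ t in (0 : ℝ)..s, b * t = b / 2 * s ^ 2 := by
    rw [intervalIntegral.integral_const_mul, integral_id]
    ring
  rw [← h1]
  exact intervalIntegral.integral_mono_on hs (Continuous.intervalIntegrable (by fun_prop) _ _)
    ((continuous_laguerreApprox K a c n).intervalIntegrable _ _) fun t ht => h t ht.1

theorem exists_laguerrePrimitive_eq {K a : ℝ} {c : ℕ → ℝ} (hK : 0 < K) (ha : 0 ≤ a)
    (hc : ∀ j, 0 ≤ c j) {n : ℕ} (hn : 0 < n) {y : ℝ} (hy : 0 < y) :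
    ∃ R > 0, laguerrePrimitive K a c n (R ^ 2) = y := by
  have h0 : laguerrePrimitive K a c n 0 = 0 := by simp [laguerrePrimitive]
  have h1 : y ≤ laguerrePrimitive K a c n (y / K) := by
    have h2 : ∫ t in (0 : ℝ)..(y / K), K = y := by
      rw [intervalIntegral.integral_const, smul_eq_mul, sub_zero, div_mul_cancel₀ _ hK.ne']
    refine h2.symm.le.trans ?_
    refine intervalIntegral.integral_mono_on (by positivity)
      (Continuous.intervalIntegrable (by fun_prop) _ _)
      ((continuous_laguerreApprox K a c n).intervalIntegrable _ _) fun t ht => ?_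
    refine le_trans ?_ (le_laguerreApprox hK.le ha hc hn ht.1)
    have h3 := Finset.sum_nonneg fun j (_ : j ∈ Finset.range n) => hc j
    have : 0 ≤ K * ((a + ∑ j ∈ Finset.range n, c j) * t) :=
      mul_nonneg hK.le (mul_nonneg (by positivity) ht.1)
    linarith
  obtain ⟨s, hs, hsy⟩ := intermediate_value_Icc (by positivity : (0 : ℝ) ≤ y / K)
    (continuous_laguerrePrimitive K a c n).continuousOn ⟨h0.trans_le hy.le, h1⟩
  have hs0 : 0 < s := lt_of_le_of_ne hs.1 fun h => by rw [← h, h0] at hsy; exact hy.ne hsy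
  exact ⟨√s, Real.sqrt_pos.2 hs0, by rw [Real.sq_sqrt hs.1, hsy]⟩

theorem tendsto_laguerrePrimitive {K a : ℝ} {c : ℕ → ℝ} (hK : 0 < K) (ha : 0 ≤ a)
    (hc : ∀ j, 0 ≤ c j) (hcs : Summable c) {g : ℝ → ℝ}
    (hg : ∀ s, 0 ≤ s → HasDerivWithinAt g (laguerreFun K a c s) (Ici 0) s) {s : ℝ}
    (hs : 0 ≤ s) :
    Tendsto (fun n => laguerrePrimitive K a c n s) atTop (𝓝 (g s - g 0)) := by
  have h1 : ∫ t in (0 : ℝ)..s, laguerreFun K a c t = g s - g 0 := by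
    have hcont : ContinuousOn g (Icc 0 s) := fun t ht =>
      ((hg t ht.1).continuousWithinAt).mono Icc_subset_Ici_self
    have hder : ∀ t ∈ Ioo 0 s, HasDerivWithinAt g (laguerreFun K a c t) (Ioi t) t :=
      fun t ht => (hg t ht.1.le).mono fun u hu => ht.1.le.trans (le_of_lt hu)
    refine intervalIntegral.integral_eq_sub_of_hasDeriv_right_of_le hs hcont hder ?_
    rw [intervalIntegrable_iff_integrableOn_Ioc_of_le hs]
    exact intervalIntegral.integrableOn_deriv_right_of_nonneg hcont hder
      fun t ht => hK.le.trans (le_laguerreFun hK.le ha hc hcs ht.1.le)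
  rw [← h1]
  refine intervalIntegral.tendsto_integral_filter_of_dominated_convergence
    (fun t => K * Real.exp ((a + ∑' j, c j) * t))
    (Eventually.of_forall fun n => (continuous_laguerreApprox K a c n).aestronglyMeasurable)
    (Eventually.of_forall fun n => Eventually.of_forall fun t ht => ?_)
    (Continuous.intervalIntegrable (by fun_prop) _ _)
    (Eventually.of_forall fun t _ => tendsto_laguerreApprox K a hcs t)
  rw [uIoc_of_le hs] at ht
  rw [Real.norm_of_nonneg (laguerreApprox_pos hK ha hc n ht.1.le).le]
  exact laguerreApprox_le hK.le ha hc hcs n ht.1.le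

theorem max_one_sub_div_pow_le {x : ℝ} {n : ℕ} (hn : 0 < n) :
    max 0 (1 - x / n) ^ n ≤ Real.exp (-x) := by
  have h1 : max 0 (1 - x / n) ≤ Real.exp (-(x / n)) :=
    max_le (Real.exp_pos _).le (by linarith [Real.add_one_le_exp (-(x / n))])
  refine (pow_le_pow_left₀ (le_max_left _ _) h1 n).trans (le_of_eq ?_)
  rw [← Real.exp_nat_mul]
  congr 1
  field_simp

theorem tendsto_max_one_sub_div_pow {x : ℕ → ℝ} {y : ℝ} (hx : Tendsto x atTop (𝓝 y)) :
    Tendsto (fun n : ℕ => max 0 (1 - x n / n) ^ n) atTop (𝓝 (Real.exp (-y))) := by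
  have h0 : Tendsto (fun n : ℕ => x n / n) atTop (𝓝 0) :=
    hx.div_atTop tendsto_natCast_atTop_atTop
  have h1 : Tendsto (fun n : ℕ => (1 + -(x n / n)) ^ n) atTop (𝓝 (Real.exp (-y))) := by
    refine Real.tendsto_one_add_pow_exp_of_tendsto (hx.neg.congr' ?_)
    filter_upwards [eventually_gt_atTop 0] with n hn
    field_simp
  refine h1.congr' ?_
  filter_upwards [h0.eventually (gt_mem_nhds one_pos)] with n hn
  rw [max_eq_right (by linarith), sub_eq_add_neg]

/-- Compactly supported approximation of the density `f e^{-(g - g 0)}` on the half-line, where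
`f = laguerreFun K a c` and `g' = laguerreFun K' a' c'`. -/
def cutoffDensity (K a : ℝ) (c : ℕ → ℝ) (K' a' : ℝ) (c' : ℕ → ℝ) (n : ℕ) (s : ℝ) : ℝ :=
  laguerreApprox K a c n s * max 0 (1 - laguerrePrimitive K' a' c' n s / n) ^ n

theorem continuous_cutoffDensity (K a : ℝ) (c : ℕ → ℝ) (K' a' : ℝ) (c' : ℕ → ℝ) (n : ℕ) :
    Continuous (cutoffDensity K a c K' a' c' n) := by
  have h1 := continuous_laguerreApprox K a c n
  have h2 := continuous_laguerrePrimitive K' a' c' n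
  unfold cutoffDensity
  fun_prop

theorem tendsto_cutoffDensity (K a : ℝ) {c : ℕ → ℝ} (hcs : Summable c)
    {K' a' : ℝ} {c' : ℕ → ℝ} (hK' : 0 < K') (ha' : 0 ≤ a') (hc' : ∀ j, 0 ≤ c' j)
    (hcs' : Summable c') {g : ℝ → ℝ}
    (hg : ∀ s, 0 ≤ s → HasDerivWithinAt g (laguerreFun K' a' c' s) (Ici 0) s) {s : ℝ}
    (hs : 0 ≤ s) :
    Tendsto (fun n => cutoffDensity K a c K' a' c' n s) atTop
      (𝓝 (laguerreFun K a c s * Real.exp (-(g s - g 0)))) :=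
  (tendsto_laguerreApprox K a hcs s).mul
    (tendsto_max_one_sub_div_pow (tendsto_laguerrePrimitive hK' ha' hc' hcs' hg hs))

theorem exists_cutoffDensity_le {K a : ℝ} {c : ℕ → ℝ} (hK : 0 < K) (ha : 0 ≤ a)
    (hc : ∀ j, 0 ≤ c j) (hcs : Summable c) {K' a' : ℝ} {c' : ℕ → ℝ} (hK' : 0 < K')
    (ha' : 0 ≤ a') (hc' : ∀ j, 0 ≤ c' j) (hac' : a' ≠ 0 ∨ ∃ j, c' j ≠ 0) (A : ℝ) :
    ∃ B, ∀ᶠ n in atTop, ∀ s, 0 ≤ s →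
      |cutoffDensity K a c K' a' c' n s| ≤ B * Real.exp (-(A * s)) := by
  obtain ⟨b, hb, hev⟩ := exists_mul_le_laguerreApprox hK' ha' hc' hac'
  set S := a + ∑' j, c j with hS
  refine ⟨K * Real.exp ((S + A) ^ 2 / (2 * b)), ?_⟩
  filter_upwards [hev, eventually_gt_atTop 0] with n hn hn0 s hs
  have h1 := laguerreApprox_le hK.le ha hc hcs n hs
  have h2 := (laguerreApprox_pos hK ha hc n hs).le
  have h3 : 0 ≤ max 0 (1 - laguerrePrimitive K' a' c' n s / n) ^ n :=
    pow_nonneg (le_max_left _ _) n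
  have h4 : max 0 (1 - laguerrePrimitive K' a' c' n s / n) ^ n ≤ Real.exp (-(b / 2 * s ^ 2)) :=
    (max_one_sub_div_pow_le hn0).trans
      (Real.exp_le_exp.2 (neg_le_neg (mul_sq_le_laguerrePrimitive hn hs)))
  rw [cutoffDensity, abs_of_nonneg (mul_nonneg h2 h3)]
  refine (mul_le_mul h1 h4 h3 (by positivity)).trans ?_
  rw [mul_assoc, mul_assoc, ← Real.exp_add, ← Real.exp_add]
  refine mul_le_mul_of_nonneg_left (Real.exp_le_exp.2 ?_) hK.le
  have h5 : (S + A) ^ 2 / (2 * b) - (S + A) * s + b / 2 * s ^ 2 =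
      (S + A - b * s) ^ 2 / (2 * b) := by
    field_simp
    ring
  have h6 : 0 ≤ (S + A - b * s) ^ 2 / (2 * b) := by positivity
  linarith

theorem integrableOn_pow_mul_exp_neg_sq (j : ℕ) :
    IntegrableOn (fun r : ℝ => r ^ j * Real.exp (-r ^ 2)) (Ioi 0) := by
  have := integrableOn_rpow_mul_exp_neg_mul_sq one_pos (s := j)
    (lt_of_lt_of_le (by norm_num) j.cast_nonneg)
  simpa using this

theorem cutoffDensity_moment_mem {K a : ℝ} {c : ℕ → ℝ} (hK : 0 < K) (ha : 0 ≤ a)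
    (hc : ∀ j, 0 ≤ c j) {K' a' : ℝ} {c' : ℕ → ℝ} (hK' : 0 < K')
    (ha' : 0 ≤ a') (hc' : ∀ j, 0 ≤ c' j) (m : ℕ) {n : ℕ} (hn : 0 < n) :
    (fun k => radialWeight m k *
      ∫ r in Ioi (0 : ℝ), r ^ (2 * k + m) * cutoffDensity K a c K' a' c' n (r ^ 2)) ∈
        closure negRootedCoeffs := by
  have hn' : (0 : ℝ) < n := Nat.cast_pos.2 hn
  obtain ⟨R, hR, hRn⟩ := exists_laguerrePrimitive_eq hK' ha' hc' hn hn'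
  have h1 := ballCoeff_mul_sub_pow_mem (m := m) hR (continuous_laguerreApprox K' a' c' n)
    (fun h hh hm => ballCoeff_laguerreApprox_mul_mem hK'.le ha' hc' n hh hm)
    (fun h hh hm => ballCoeff_laguerreApprox_mul_mem hK.le ha hc n hh hm)
    (hasDerivAt_laguerrePrimitive K' a' c' n) hRn n
  convert const_mul_mem_closure h1 (c := ((n : ℝ) ^ n)⁻¹) (by positivity) using 1
  ext k
  have hmono := monotoneOn_laguerrePrimitive hK' ha' hc' n
  have e : ∫ r in Ioi (0 : ℝ), r ^ (2 * k + m) * cutoffDensity K a c K' a' c' n (r ^ 2) =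
      ((n : ℝ) ^ n)⁻¹ * ∫ r in (0 : ℝ)..R, r ^ (2 * k + m) *
        (laguerreApprox K a c n (r ^ 2) * (n - laguerrePrimitive K' a' c' n (r ^ 2)) ^ n) := by
    rw [← intervalIntegral.integral_const_mul, intervalIntegral.integral_of_le hR.le]
    rw [setIntegral_eq_of_subset_of_forall_sdiff_eq_zero measurableSet_Ioi
      (Ioc_subset_Ioi_self : Ioc 0 R ⊆ Ioi 0)]
    · refine setIntegral_congr_fun measurableSet_Ioc fun r hr => ?_
      have h2 : laguerrePrimitive K' a' c' n (r ^ 2) ≤ n := by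
        rw [← hRn]
        exact hmono (sq_nonneg r) (sq_nonneg R) (pow_le_pow_left₀ hr.1.le hr.2 2)
      have h3 : max 0 (1 - laguerrePrimitive K' a' c' n (r ^ 2) / n) =
          (n : ℝ)⁻¹ * (n - laguerrePrimitive K' a' c' n (r ^ 2)) := by
        rw [max_eq_right]
        · field_simp
        · rw [sub_nonneg, div_le_one hn']
          exact h2
      simp only [cutoffDensity]
      rw [h3, mul_pow, inv_pow]
      ring
    · intro r hr
      have hrR : R < r := by
        by_contra h
        exact hr.2 ⟨hr.1, not_lt.1 h⟩
      have h2 : (n : ℝ) ≤ laguerrePrimitive K' a' c' n (r ^ 2) := by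
        rw [← hRn]
        exact hmono (sq_nonneg R) (sq_nonneg r) (pow_le_pow_left₀ hR.le hrR.le 2)
      rw [cutoffDensity, max_eq_left, zero_pow hn.ne', mul_zero, mul_zero]
      rw [sub_nonpos, one_le_div hn']
      exact h2
  rw [e, ballCoeff]
  ring

theorem density_moment_mem {K a : ℝ} {c : ℕ → ℝ} (hK : 0 < K) (ha : 0 ≤ a)
    (hc : ∀ j, 0 ≤ c j) (hcs : Summable c) {K' a' : ℝ} {c' : ℕ → ℝ} (hK' : 0 < K')
    (ha' : 0 ≤ a') (hc' : ∀ j, 0 ≤ c' j) (hcs' : Summable c') (hac' : a' ≠ 0 ∨ ∃ j, c' j ≠ 0)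
    {g : ℝ → ℝ} (hg : ∀ s, 0 ≤ s → HasDerivWithinAt g (laguerreFun K' a' c' s) (Ici 0) s)
    (m : ℕ) :
    (fun k => radialWeight m k * ∫ r in Ioi (0 : ℝ), r ^ (2 * k + m) *
      (laguerreFun K a c (r ^ 2) * Real.exp (-(g (r ^ 2) - g 0)))) ∈
        closure negRootedCoeffs := by
  rw [← closure_closure]
  refine mem_closure_of_tendsto (b := atTop) (f := fun n k => radialWeight m k *
    ∫ r in Ioi (0 : ℝ), r ^ (2 * k + m) * cutoffDensity K a c K' a' c' n (r ^ 2)) ?_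
    ((eventually_gt_atTop 0).mono fun n hn =>
      cutoffDensity_moment_mem hK ha hc hK' ha' hc' m hn)
  rw [tendsto_pi_nhds]
  intro k
  refine Tendsto.const_mul _ ?_
  obtain ⟨B, hB⟩ := exists_cutoffDensity_le hK ha hc hcs hK' ha' hc' hac' 1
  refine tendsto_integral_filter_of_dominated_convergence
    (fun r => B * (r ^ (2 * k + m) * Real.exp (-r ^ 2))) ?_ ?_
    ((integrableOn_pow_mul_exp_neg_sq _).const_mul B) ?_
  · refine Eventually.of_forall fun n => Continuous.aestronglyMeasurable ?_
    have := continuous_cutoffDensity K a c K' a' c' n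
    fun_prop
  · filter_upwards [hB] with n hn
    refine (ae_restrict_iff' measurableSet_Ioi).2 (Eventually.of_forall fun r hr => ?_)
    have hr0 : (0 : ℝ) ≤ r := le_of_lt hr
    rw [Real.norm_eq_abs, abs_mul, abs_of_nonneg (pow_nonneg hr0 _)]
    calc _ ≤ r ^ (2 * k + m) * (B * Real.exp (-(1 * r ^ 2))) := by
          gcongr
          exact hn _ (sq_nonneg r)
      _ = _ := by rw [one_mul]; ring
  · exact Eventually.of_forall fun r => (tendsto_cutoffDensity K a hcs hK' ha' hc' hcs' hg
      (sq_nonneg r)).const_mul _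

theorem measurable_density (K a : ℝ) {c : ℕ → ℝ} (hcs : Summable c)
    {K' a' : ℝ} {c' : ℕ → ℝ} (hK' : 0 < K') (ha' : 0 ≤ a') (hc' : ∀ j, 0 ≤ c' j)
    (hcs' : Summable c') {g : ℝ → ℝ}
    (hg : ∀ s, 0 ≤ s → HasDerivWithinAt g (laguerreFun K' a' c' s) (Ici 0) s) :
    Measurable fun r : ℝ => laguerreFun K a c (r ^ 2) * Real.exp (-(g (r ^ 2) - g 0)) := by
  refine measurable_of_tendsto_metrizable
    (f := fun n r => cutoffDensity K a c K' a' c' n (r ^ 2)) (fun n => ?_) ?_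
  · have := continuous_cutoffDensity K a c K' a' c' n
    exact Continuous.measurable (by fun_prop)
  · rw [tendsto_pi_nhds]
    exact fun r => tendsto_cutoffDensity K a hcs hK' ha' hc' hcs' hg (sq_nonneg r)

theorem exists_density_le {K a : ℝ} {c : ℕ → ℝ} (hK : 0 < K) (ha : 0 ≤ a)
    (hc : ∀ j, 0 ≤ c j) (hcs : Summable c) {K' a' : ℝ} {c' : ℕ → ℝ} (hK' : 0 < K')
    (ha' : 0 ≤ a') (hc' : ∀ j, 0 ≤ c' j) (hcs' : Summable c') (hac' : a' ≠ 0 ∨ ∃ j, c' j ≠ 0)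
    {g : ℝ → ℝ} (hg : ∀ s, 0 ≤ s → HasDerivWithinAt g (laguerreFun K' a' c' s) (Ici 0) s)
    (A : ℝ) :
    ∃ B, ∀ s, 0 ≤ s →
      |laguerreFun K a c s * Real.exp (-(g s - g 0))| ≤ B * Real.exp (-(A * s)) := by
  obtain ⟨B, hB⟩ := exists_cutoffDensity_le hK ha hc hcs hK' ha' hc' hac' A
  exact ⟨B, fun s hs => le_of_tendsto
    (tendsto_cutoffDensity K a hcs hK' ha' hc' hcs' hg hs).abs (hB.mono fun n hn => hn s hs)⟩

theorem hasSum_of_forall_eq {f g : ℕ → ℂ} {a : ℂ} (h : HasSum f a) (e : ∀ n, f n = g n) :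
    HasSum g a :=
  funext e ▸ h

theorem rdot_self_nonneg {D : ℕ} (σ : Fin D → ℝ) : 0 ≤ rdot σ σ :=
  Finset.sum_nonneg fun j _ => mul_self_nonneg (σ j)

theorem cpair_smul_left {D : ℕ} (t : ℂ) (z : Fin D → ℂ) (σ : Fin D → ℝ) :
    cpair (t • z) σ = t * cpair z σ := by
  simp [cpair, Finset.mul_sum, mul_assoc]

theorem cpair_smul_right {D : ℕ} (r : ℝ) (z : Fin D → ℂ) (σ : Fin D → ℝ) :
    cpair z (r • σ) = r * cpair z σ := by
  simp [cpair, Finset.mul_sum, mul_left_comm]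

/-- Moments of the linear form `z · u` over the unit sphere. -/
def sphereMoment (m n : ℕ) (z : Fin (m + 1) → ℂ) : ℂ :=
  ∫ u : Metric.sphere (0 : EuclideanSpace ℝ (Fin (m + 1))) 1, cpair z u.1.ofLp ^ n
    ∂(volume : Measure (EuclideanSpace ℝ (Fin (m + 1)))).toSphere

theorem integral_euclidean_polar {m : ℕ} (F : EuclideanSpace ℝ (Fin (m + 1)) → ℂ) :
    ∫ x, F x = ∫ p : Metric.sphere (0 : EuclideanSpace ℝ (Fin (m + 1))) 1 × Ioi (0 : ℝ),
      F (p.2.1 • p.1.1) ∂((volume : Measure (EuclideanSpace ℝ (Fin (m + 1)))).toSphere.prod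
        (Measure.volumeIoiPow m)) := by
  have h1 : ∫ x, F x = ∫ x : ({(0)}ᶜ : Set (EuclideanSpace ℝ (Fin (m + 1)))), F x.1
      ∂(volume.comap Subtype.val) := by
    rw [integral_subtype_comap (measurableSet_singleton _).compl F,
      restrict_compl_singleton]
  have h2 := (volume : Measure (EuclideanSpace ℝ (Fin (m + 1))))
    |>.measurePreserving_homeomorphUnitSphereProd.integral_comp
      (Homeomorph.measurableEmbedding _) (fun p => F (p.2.1 • p.1.1))
  rw [finrank_euclideanSpace, Fintype.card_fin, Nat.add_sub_cancel] at h2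
  rw [h1, ← h2]
  congr 1
  ext x
  have hx : x.1 ≠ 0 := x.2
  simp [smul_smul, hx]

theorem integral_volumeIoiPow (m : ℕ) (f : ℝ → ℂ) :
    ∫ r : Ioi (0 : ℝ), f r ∂(Measure.volumeIoiPow m) =
      ∫ r in Ioi (0 : ℝ), (r : ℂ) ^ m * f r := by
  simp only [Measure.volumeIoiPow, ENNReal.ofReal]
  rw [integral_withDensity_eq_integral_smul,
    integral_subtype_comap measurableSet_Ioi fun a ↦ Real.toNNReal (a ^ m) • f a,
    setIntegral_congr_fun measurableSet_Ioi fun x hx ↦ ?_]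
  · rw [NNReal.smul_def, Real.coe_toNNReal _ (pow_nonneg (le_of_lt hx) _)]
    simp
  · exact (measurable_subtype_coe.pow_const _).real_toNNReal

theorem integral_cpair_pow_mul_radial (m n : ℕ) (z : Fin (m + 1) → ℂ) (φ : ℝ → ℝ) :
    ∫ σ : Fin (m + 1) → ℝ, cpair z σ ^ n * (φ (√(rdot σ σ)) : ℂ) =
      sphereMoment m n z * ((∫ r in Ioi (0 : ℝ), r ^ (n + m) * φ r : ℝ) : ℂ) := by
  have h1 := (PiLp.volume_preserving_ofLp (Fin (m + 1))).integral_comp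
    (MeasurableEquiv.toLp 2 (Fin (m + 1) → ℝ)).symm.measurableEmbedding
    (fun σ : Fin (m + 1) → ℝ => cpair z σ ^ n * (φ (√(rdot σ σ)) : ℂ))
  rw [← h1, integral_euclidean_polar]
  have h2 : ∀ p : Metric.sphere (0 : EuclideanSpace ℝ (Fin (m + 1))) 1 × Ioi (0 : ℝ),
      cpair z (p.2.1 • p.1.1).ofLp ^ n *
        (φ (√(rdot (p.2.1 • p.1.1).ofLp (p.2.1 • p.1.1).ofLp)) : ℂ) =
      cpair z p.1.1.ofLp ^ n * (((p.2.1 : ℝ) : ℂ) ^ n * (φ p.2.1 : ℂ)) := by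
    intro p
    have h3 : rdot (p.2.1 • p.1.1).ofLp (p.2.1 • p.1.1).ofLp = ‖p.2.1 • p.1.1‖ ^ 2 := by
      rw [EuclideanSpace.real_norm_sq_eq]
      exact Finset.sum_congr rfl fun j _ => (sq _).symm
    have h4 : ‖p.2.1 • p.1.1‖ = p.2.1 := by
      rw [norm_smul, Real.norm_of_nonneg (le_of_lt p.2.2), mem_sphere_zero_iff_norm.1 p.1.2,
        mul_one]
    rw [h3, h4, Real.sqrt_sq (le_of_lt p.2.2), WithLp.ofLp_smul, cpair_smul_right, mul_pow]
    ring
  simp_rw [h2]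
  rw [integral_prod_mul (fun u : Metric.sphere (0 : EuclideanSpace ℝ (Fin (m + 1))) 1 =>
    cpair z u.1.ofLp ^ n) (fun r : Ioi (0 : ℝ) => ((r.1 : ℝ) : ℂ) ^ n * (φ r.1 : ℂ)),
    integral_volumeIoiPow m (fun r => (r : ℂ) ^ n * (φ r : ℂ)), ← integral_complex_ofReal,
    sphereMoment]
  congr 2
  ext r
  push_cast
  ring

theorem integrable_exp_norm_cpair_mul_gaussian {D : ℕ} (z : Fin D → ℂ) :
    Integrable fun σ : Fin D → ℝ => Real.exp ‖cpair z σ‖ * Real.exp (-rdot σ σ) := by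
  have h1 : Integrable fun σ : Fin D → ℝ =>
      Real.exp (∑ j, ‖z j‖ ^ 2 / 2) * ∏ j, Real.exp (-(1 / 2) * σ j ^ 2) :=
    (Integrable.fintype_prod (f := fun _ x => Real.exp (-(1 / 2) * x ^ 2))
      fun _ => integrable_exp_neg_mul_sq (by norm_num)).const_mul _
  refine h1.mono' (Continuous.aestronglyMeasurable ?_) (Eventually.of_forall fun σ => ?_)
  · unfold cpair rdot
    fun_prop
  · rw [Real.norm_of_nonneg (by positivity), ← Real.exp_add, ← Real.exp_sum, ← Real.exp_add]
    refine Real.exp_le_exp.2 ?_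
    have h2 : ‖cpair z σ‖ ≤ ∑ j, ‖z j‖ * |σ j| := by
      refine (norm_sum_le _ _).trans (le_of_eq (Finset.sum_congr rfl fun j _ => ?_))
      rw [norm_mul, Complex.norm_real, Real.norm_eq_abs]
    have h3 : ∑ j, ‖z j‖ * |σ j| ≤ ∑ j, (‖z j‖ ^ 2 / 2 + -(1 / 2) * σ j ^ 2 + σ j * σ j) := by
      refine Finset.sum_le_sum fun j _ => ?_
      nlinarith [sq_nonneg (‖z j‖ - |σ j|), sq_abs (σ j)]
    rw [Finset.sum_add_distrib, Finset.sum_add_distrib] at h3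
    rw [rdot]
    linarith

theorem hasSum_integral_cexp_cpair_mul_radial {m : ℕ} {φ : ℝ → ℝ} (hφ : Measurable φ) {B : ℝ}
    (hB : ∀ r, 0 ≤ r → |φ r| ≤ B * Real.exp (-r ^ 2)) (z : Fin (m + 1) → ℂ) :
    HasSum (fun n : ℕ => sphereMoment m n z / n.factorial *
        ((∫ r in Ioi (0 : ℝ), r ^ (n + m) * φ r : ℝ) : ℂ))
      (∫ σ : Fin (m + 1) → ℝ, Complex.exp (cpair z σ) * (φ (√(rdot σ σ)) : ℂ)) := by
  have hcp : Continuous fun σ : Fin (m + 1) → ℝ => cpair z σ := by unfold cpair; fun_prop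
  have hrd : Continuous fun σ : Fin (m + 1) → ℝ => rdot σ σ := by unfold rdot; fun_prop
  have key := hasSum_integral_of_dominated_convergence (μ := volume)
    (F := fun (n : ℕ) (σ : Fin (m + 1) → ℝ) =>
      (n.factorial : ℂ)⁻¹ * (cpair z σ ^ n * (φ (√(rdot σ σ)) : ℂ)))
    (f := fun σ => Complex.exp (cpair z σ) * (φ (√(rdot σ σ)) : ℂ))
    (fun (n : ℕ) σ => ‖cpair z σ‖ ^ n / n.factorial * (B * Real.exp (-rdot σ σ))) ?_ ?_ ?_ ?_ ?_
  · refine hasSum_of_forall_eq key fun n => ?_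
    rw [integral_const_mul, integral_cpair_pow_mul_radial]
    ring
  · intro n
    have h1 : Measurable fun σ : Fin (m + 1) → ℝ => (φ (√(rdot σ σ)) : ℂ) :=
      Complex.measurable_ofReal.comp (hφ.comp hrd.sqrt.measurable)
    exact (((hcp.pow n).measurable.mul h1).const_mul _).aestronglyMeasurable
  · refine fun n => Eventually.of_forall fun σ => ?_
    have h1 := hB _ (Real.sqrt_nonneg (rdot σ σ))
    rw [Real.sq_sqrt (rdot_self_nonneg σ)] at h1
    rw [norm_mul, norm_mul, norm_pow, norm_inv, Complex.norm_natCast, Complex.norm_real,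
      Real.norm_eq_abs, ← mul_assoc, div_eq_inv_mul]
    gcongr
  · exact Eventually.of_forall fun σ => (Real.summable_pow_div_factorial _).mul_right _
  · have h1 : (fun σ : Fin (m + 1) → ℝ =>
        ∑' n : ℕ, ‖cpair z σ‖ ^ n / n.factorial * (B * Real.exp (-rdot σ σ))) =
        fun σ => B * (Real.exp ‖cpair z σ‖ * Real.exp (-rdot σ σ)) := by
      ext σ
      rw [tsum_mul_right, Real.exp_eq_exp_ℝ,
        (NormedSpace.expSeries_div_hasSum_exp ‖cpair z σ‖).tsum_eq]
      ring
    rw [h1]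
    exact (integrable_exp_norm_cpair_mul_gaussian z).const_mul B
  · refine Eventually.of_forall fun σ => ?_
    have h1 : HasSum (fun n : ℕ => cpair z σ ^ n / n.factorial) (Complex.exp (cpair z σ)) := by
      rw [Complex.exp_eq_exp_ℂ]
      exact NormedSpace.expSeries_div_hasSum_exp _
    refine hasSum_of_forall_eq (h1.mul_right (φ (√(rdot σ σ)) : ℂ)) fun n => ?_
    ring

theorem coeff_unique {a b : ℕ → ℂ} {F : ℂ → ℂ} (ha : ∀ t, HasSum (fun n => a n * t ^ n) (F t))
    (hb : ∀ t, HasSum (fun n => b n * t ^ n) (F t)) : a = b := by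
  have key : ∀ c : ℕ → ℂ, (∀ t, HasSum (fun n => c n * t ^ n) (F t)) →
      HasFPowerSeriesAt F (FormalMultilinearSeries.ofScalars ℂ c) 0 := by
    intro c hc
    rw [hasFPowerSeriesAt_iff]
    refine Eventually.of_forall fun t => ?_
    rw [zero_add]
    refine hasSum_of_forall_eq (hc t) fun n => ?_
    rw [FormalMultilinearSeries.coeff_ofScalars, smul_eq_mul, mul_comm]
  have h := (key a ha).eq_formalMultilinearSeries (key b hb)
  ext n
  simpa using congrArg (fun p => FormalMultilinearSeries.coeff p n) h

theorem hasSum_even_iff {f : ℕ → ℂ} {a : ℂ} (hf : ∀ k, f (2 * k + 1) = 0) :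
    HasSum (fun k => f (2 * k)) a ↔ HasSum f a := by
  refine Function.Injective.hasSum_iff (g := fun k : ℕ => 2 * k)
    (fun i j h => by simpa using h) fun n hn => ?_
  rcases Nat.even_or_odd' n with ⟨k, rfl | rfl⟩
  · exact absurd ⟨k, rfl⟩ hn
  · exact hf k

/-- The moments of the Gaussian `e^{-r²}` on the half-line. -/
def gaussianMoment (n : ℕ) : ℝ := ∫ r in Ioi (0 : ℝ), r ^ n * Real.exp (-r ^ 2)

theorem gaussianMoment_eq (n : ℕ) : gaussianMoment n = 1 / 2 * Real.Gamma ((n + 1) / 2) := by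
  have := integral_rpow_mul_exp_neg_rpow two_pos (q := n)
    (lt_of_lt_of_le (by norm_num) n.cast_nonneg)
  simpa [gaussianMoment] using this

theorem gaussianMoment_pos (n : ℕ) : 0 < gaussianMoment n := by
  rw [gaussianMoment_eq]
  exact mul_pos (by norm_num) (Real.Gamma_pos_of_pos (by positivity))

theorem gaussianMoment_add_two (n : ℕ) :
    gaussianMoment (n + 2) = (n + 1) / 2 * gaussianMoment n := by
  rw [gaussianMoment_eq, gaussianMoment_eq]
  have h : (((n + 2 : ℕ) : ℝ) + 1) / 2 = (n + 1) / 2 + 1 := by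
    push_cast
    ring
  rw [h, Real.Gamma_add_one (by positivity)]
  ring

theorem radialWeight_mul_gaussianMoment (m k : ℕ) :
    radialWeight m k * gaussianMoment (2 * k + m) * (4 ^ k * k.factorial) = gaussianMoment m := by
  induction k with
  | zero => simp [radialWeight]
  | succ k ih =>
    rw [← ih, ← radialWeight_succ m k, show 2 * (k + 1) + m = 2 * k + m + 2 by ring,
      gaussianMoment_add_two, Nat.factorial_succ]
    push_cast
    ring

theorem integral_cexp_cpair_mul_gaussian {D : ℕ} (z : Fin D → ℂ) :
    ∫ σ : Fin D → ℝ, Complex.exp (cpair z σ) * (Real.exp (-√(rdot σ σ) ^ 2) : ℂ) =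
      ((Real.pi ^ (D / 2 : ℝ) : ℝ) : ℂ) * Complex.exp (cdot z z / 4) := by
  have h := GaussianFourier.integral_cexp_neg_mul_sum_add (b := 1) (by simp) z
  have h1 : ((Real.pi ^ (D / 2 : ℝ) : ℝ) : ℂ) =
      ((Real.pi : ℂ) / 1) ^ (Fintype.card (Fin D) / 2 : ℂ) := by
    rw [Complex.ofReal_cpow Real.pi_pos.le]
    simp
  have h2 : cdot z z / 4 = (∑ i, z i ^ 2) / (4 * 1) := by
    simp [cdot, sq]
  rw [h1, h2, ← h]
  congr 1
  ext σ
  rw [Real.sq_sqrt (rdot_self_nonneg σ), Complex.ofReal_exp, ← Complex.exp_add, add_comm]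
  congr 2
  simp [rdot, sq]

theorem sphereMoment_smul {m n : ℕ} (t : ℂ) (z : Fin (m + 1) → ℂ) :
    sphereMoment m n (t • z) = sphereMoment m n z * t ^ n := by
  simp_rw [sphereMoment, cpair_smul_left, mul_pow]
  rw [integral_const_mul, mul_comm]

theorem sphereMoment_eq {m : ℕ} (z : Fin (m + 1) → ℂ) (n : ℕ) :
    sphereMoment m n z / n.factorial * gaussianMoment (n + m) =
      if Even n then ((Real.pi ^ ((m + 1 : ℕ) / 2 : ℝ) : ℝ) : ℂ) *
        ((cdot z z / 4) ^ (n / 2) / (n / 2).factorial) else 0 := by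
  refine congrFun (coeff_unique
    (a := fun n => sphereMoment m n z / n.factorial * gaussianMoment (n + m))
    (b := fun n => if Even n then ((Real.pi ^ ((m + 1 : ℕ) / 2 : ℝ) : ℝ) : ℂ) *
      ((cdot z z / 4) ^ (n / 2) / (n / 2).factorial) else 0)
    (F := fun t => ((Real.pi ^ ((m + 1 : ℕ) / 2 : ℝ) : ℝ) : ℂ) *
    Complex.exp (t ^ 2 * (cdot z z / 4))) (fun t => ?_) fun t => ?_) n
  · have h := hasSum_integral_cexp_cpair_mul_radial (m := m) (φ := fun r => Real.exp (-r ^ 2))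
      (by fun_prop) (B := 1) (fun r _ => by rw [one_mul, Real.abs_exp]) (t • z)
    rw [integral_cexp_cpair_mul_gaussian] at h
    have h2 : cdot (t • z) (t • z) / 4 = t ^ 2 * (cdot z z / 4) := by
      simp only [cdot, Finset.sum_div, Finset.mul_sum, Pi.smul_apply, smul_eq_mul]
      exact Finset.sum_congr rfl fun j _ => by ring
    rw [h2] at h
    refine hasSum_of_forall_eq h fun n => ?_
    rw [sphereMoment_smul, gaussianMoment]
    ring
  · refine (hasSum_even_iff fun k => ?_).1 ?_
    · rw [if_neg (by simp), zero_mul]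
    · have h1 : HasSum (fun n : ℕ => (t ^ 2 * (cdot z z / 4)) ^ n / n.factorial)
          (Complex.exp (t ^ 2 * (cdot z z / 4))) := by
        rw [Complex.exp_eq_exp_ℂ]
        exact NormedSpace.expSeries_div_hasSum_exp _
      refine hasSum_of_forall_eq (h1.mul_left _) fun k => ?_
      rw [if_pos (even_two_mul k), Nat.mul_div_cancel_left _ two_pos]
      ring

/-- The Taylor expansion in `w = z²` of the Laplace transform of a radial density. -/
theorem hasSum_laplace_radial {m : ℕ} {φ : ℝ → ℝ} (hφ : Measurable φ) {B : ℝ}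
    (hB : ∀ r, 0 ≤ r → |φ r| ≤ B * Real.exp (-r ^ 2)) (z : Fin (m + 1) → ℂ) :
    HasSum (fun k : ℕ => ((Real.pi ^ ((m + 1 : ℕ) / 2 : ℝ) / gaussianMoment m : ℝ) : ℂ) *
        (((radialWeight m k * ∫ r in Ioi (0 : ℝ), r ^ (2 * k + m) * φ r : ℝ) : ℂ) *
          cdot z z ^ k))
      (∫ σ : Fin (m + 1) → ℝ, Complex.exp (cpair z σ) * (φ (√(rdot σ σ)) : ℂ)) := by
  have hne : ∀ n, (gaussianMoment n : ℂ) ≠ 0 := fun n =>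
    Complex.ofReal_ne_zero.2 (gaussianMoment_pos n).ne'
  have h := hasSum_integral_cexp_cpair_mul_radial hφ hB z
  rw [← hasSum_even_iff fun k => ?_] at h
  · refine hasSum_of_forall_eq h fun k => ?_
    have h1 := sphereMoment_eq z (2 * k)
    rw [if_pos (even_two_mul k), Nat.mul_div_cancel_left _ two_pos, ← eq_div_iff (hne _)] at h1
    have h2 : (radialWeight m k : ℂ) * gaussianMoment (2 * k + m) * (4 ^ k * k.factorial) =
        gaussianMoment m := by
      exact_mod_cast radialWeight_mul_gaussianMoment m k
    rw [h1]
    push_cast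
    rw [← h2]
    have h3 := hne (2 * k + m)
    have h4 : (radialWeight m k : ℂ) ≠ 0 :=
      Complex.ofReal_ne_zero.2 (radialWeight_pos m k).ne'
    have h5 : (k.factorial : ℂ) ≠ 0 := Nat.cast_ne_zero.2 k.factorial_ne_zero
    rw [div_pow]
    field_simp
  · have h1 := sphereMoment_eq z (2 * k + 1)
    rw [if_neg (by simp)] at h1
    rw [(mul_eq_zero.1 h1).resolve_right (hne _), zero_mul]

theorem ofReal_laguerreFun (K a : ℝ) {c : ℕ → ℝ} (hc : Summable c) (s : ℝ) :
    ((laguerreFun K a c s : ℝ) : ℂ) =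
      K * Complex.exp (a * s) * ∏' j, (1 + (c j : ℂ) * s) := by
  have h1 : Multipliable fun j => 1 + c j * s :=
    multipliable_one_add_of_summable ((hc.mul_right s).norm)
  have h2 : HasProd (fun j => 1 + (c j : ℂ) * s) ((∏' j, (1 + c j * s) : ℝ) : ℂ) := by
    have := h1.hasProd.map Complex.ofRealHom Complex.continuous_ofReal
    simpa [Function.comp_def] using this
  rw [h2.tprod_eq, laguerreFun]
  push_cast
  ring

theorem mul_exp_le_laguerreFun {K a : ℝ} {c : ℕ → ℝ} (hK : 0 ≤ K)
    (hc : ∀ j, 0 ≤ c j) (hcs : Summable c) {s : ℝ} (hs : 0 ≤ s) :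
    K * Real.exp (a * s) ≤ laguerreFun K a c s := by
  have := le_laguerreFun (K := K * Real.exp (a * s)) (a := 0) (by positivity) le_rfl hc hcs hs
  simpa [laguerreFun] using this

theorem nonpos_of_exp_growth {K b : ℝ} (hK : 0 < K)
    (h : ∀ A > 0, ∃ Q, ∀ x, 0 ≤ x → K * Real.exp (b * x) ≤ Q * Real.exp (x / (4 * A))) :
    b ≤ 0 := by
  by_contra! hb
  obtain ⟨Q, hQ⟩ := h (1 / (2 * b)) (by positivity)
  have h1 := hQ (2 * |Q| / (K * b)) (by positivity)
  set x := 2 * |Q| / (K * b) with hx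
  have h2 : b * x = b * x / 2 + x / (4 * (1 / (2 * b))) := by
    field_simp
    ring
  rw [h2, Real.exp_add, ← mul_assoc] at h1
  have h3 := le_of_mul_le_mul_right h1 (Real.exp_pos _)
  have h4 := Real.add_one_le_exp (b * x / 2)
  have h5 : K * (b * x / 2) = |Q| := by
    rw [hx]
    field_simp
  nlinarith [le_abs_self Q]

theorem exists_norm_laplace_radial_le {m : ℕ} {φ : ℝ → ℝ}
    (hB : ∀ A, ∃ B, ∀ r, 0 ≤ r → |φ r| ≤ B * Real.exp (-(A * r ^ 2))) {A : ℝ} (hA : 0 < A) :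
    ∃ Q, ∀ x, 0 ≤ x → ‖∫ σ : Fin (m + 1) → ℝ,
      Complex.exp (cpair (Pi.single 0 ((√x : ℝ) : ℂ)) σ) * (φ (√(rdot σ σ)) : ℂ)‖ ≤
        Q * Real.exp (x / (4 * A)) := by
  obtain ⟨B, hB⟩ := hB (A + 1)
  refine ⟨B * ∫ σ : Fin (m + 1) → ℝ, Real.exp (-rdot σ σ), fun x hx => ?_⟩
  have hint : Integrable fun σ : Fin (m + 1) → ℝ => Real.exp (-rdot σ σ) := by
    simpa [cpair] using integrable_exp_norm_cpair_mul_gaussian (0 : Fin (m + 1) → ℂ)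
  have e : B * (∫ σ : Fin (m + 1) → ℝ, Real.exp (-rdot σ σ)) * Real.exp (x / (4 * A)) =
      ∫ σ : Fin (m + 1) → ℝ, B * Real.exp (x / (4 * A)) * Real.exp (-rdot σ σ) := by
    rw [integral_const_mul]
    ring
  rw [e]
  refine norm_integral_le_of_norm_le (hint.const_mul _) (Eventually.of_forall fun σ => ?_)
  have h1 := hB _ (Real.sqrt_nonneg (rdot σ σ))
  rw [Real.sq_sqrt (rdot_self_nonneg σ)] at h1
  have h2 : cpair (Pi.single 0 ((√x : ℝ) : ℂ)) σ = ((√x * σ 0 : ℝ) : ℂ) := by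
    rw [cpair, Finset.sum_eq_single 0] <;> simp +contextual
  have h3 : σ 0 * σ 0 ≤ rdot σ σ :=
    Finset.single_le_sum (f := fun j => σ j * σ j) (fun j _ => mul_self_nonneg (σ j))
      (Finset.mem_univ 0)
  have h4 : √x * σ 0 ≤ x / (4 * A) + A * (σ 0 * σ 0) := by
    have h5 : x / (4 * A) + A * (σ 0 * σ 0) - √x * σ 0 = (√x - 2 * A * σ 0) ^ 2 / (4 * A) := by
      field_simp
      rw [sub_sq, Real.sq_sqrt hx]
      ring
    have h6 : 0 ≤ (√x - 2 * A * σ 0) ^ 2 / (4 * A) := by positivity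
    linarith
  have hB0 : 0 ≤ B := nonneg_of_mul_nonneg_left ((abs_nonneg _).trans h1) (Real.exp_pos _)
  rw [h2, ← Complex.ofReal_exp, norm_mul, Complex.norm_real, Complex.norm_real,
    Real.norm_of_nonneg (Real.exp_pos _).le, Real.norm_eq_abs]
  calc _ ≤ Real.exp (√x * σ 0) * (B * Real.exp (-((A + 1) * rdot σ σ))) := by gcongr
    _ = B * Real.exp (√x * σ 0 + -((A + 1) * rdot σ σ)) := by rw [Real.exp_add]; ring
    _ ≤ B * Real.exp (x / (4 * A) + -rdot σ σ) := by
        refine mul_le_mul_of_nonneg_left (Real.exp_le_exp.2 ?_) hB0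
        nlinarith [mul_le_mul_of_nonneg_left h3 hA.le]
    _ = _ := by rw [Real.exp_add]; ring

theorem integral_pow_mul_pos {φ : ℝ → ℝ} (hφ : Measurable φ) (hpos : ∀ r, 0 < φ r) {B : ℝ}
    (hB : ∀ r, 0 ≤ r → |φ r| ≤ B * Real.exp (-r ^ 2)) (j : ℕ) :
    0 < ∫ r in Ioi (0 : ℝ), r ^ j * φ r := by
  have hint : IntegrableOn (fun r => r ^ j * φ r) (Ioi 0) := by
    refine ((integrableOn_pow_mul_exp_neg_sq j).const_mul B).mono'
      ((measurable_id.pow_const j).mul hφ).aestronglyMeasurable ?_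
    refine (ae_restrict_iff' measurableSet_Ioi).2 (Eventually.of_forall fun r hr => ?_)
    have hr0 : (0 : ℝ) ≤ r := le_of_lt hr
    rw [Real.norm_eq_abs, abs_mul, abs_of_nonneg (pow_nonneg hr0 _)]
    calc _ ≤ r ^ j * (B * Real.exp (-r ^ 2)) := by
          gcongr
          exact hB r hr0
      _ = _ := by ring
  rw [setIntegral_pos_iff_support_of_nonneg_ae _ hint]
  · have : Ioi (0 : ℝ) ⊆ (Function.support fun r => r ^ j * φ r) ∩ Ioi 0 := fun r hr =>
      ⟨(mul_pos (pow_pos hr j) (hpos r)).ne', hr⟩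
    exact lt_of_lt_of_le (by simp) (measure_mono this)
  · exact (ae_restrict_iff' measurableSet_Ioi).2 (Eventually.of_forall fun r hr =>
      (mul_pos (pow_pos hr j) (hpos r)).le)

theorem exists_laplace_radial_eq_tprod {m : ℕ} {φ : ℝ → ℝ} (hφ : Measurable φ)
    (hpos : ∀ r, 0 < φ r)
    (hB : ∀ A, ∃ B, ∀ r, 0 ≤ r → |φ r| ≤ B * Real.exp (-(A * r ^ 2)))
    (hmem : (fun k => radialWeight m k * ∫ r in Ioi (0 : ℝ), r ^ (2 * k + m) * φ r) ∈
      closure negRootedCoeffs) :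
    ∃ (K : ℝ) (lam : ℕ → ℝ), 0 < K ∧ (∀ j, 0 ≤ lam j) ∧ Summable lam ∧
      ∀ z : Fin (m + 1) → ℂ,
        ∫ σ : Fin (m + 1) → ℝ, Complex.exp (cpair z σ) * (φ (√(rdot σ σ)) : ℂ) =
          K * ∏' j, (1 + (lam j : ℂ) * cdot z z) := by
  obtain ⟨B, hB1⟩ := hB 1
  simp only [one_mul] at hB1
  have h0 : 0 < radialWeight m 0 * ∫ r in Ioi (0 : ℝ), r ^ (2 * 0 + m) * φ r :=
    mul_pos (radialWeight_pos m 0) (integral_pow_mul_pos hφ hpos hB1 _)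
  obtain ⟨b, lam, hb, hlam, hlams, hsum⟩ := hasSum_of_mem_closure hmem h0
  set K := Real.pi ^ ((m + 1 : ℕ) / 2 : ℝ) / gaussianMoment m *
    (radialWeight m 0 * ∫ r in Ioi (0 : ℝ), r ^ (2 * 0 + m) * φ r) with hK
  have hK0 : 0 < K := mul_pos (div_pos (by positivity) (gaussianMoment_pos m)) h0
  have hlap : ∀ z : Fin (m + 1) → ℂ,
      ∫ σ : Fin (m + 1) → ℝ, Complex.exp (cpair z σ) * (φ (√(rdot σ σ)) : ℂ) =
        K * Complex.exp (b * cdot z z) * ∏' j, (1 + (lam j : ℂ) * cdot z z) := by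
    intro z
    rw [(hasSum_laplace_radial hφ hB1 z).unique ((hsum (cdot z z)).mul_left _), hK]
    push_cast
    ring
  have hb0 : b = 0 := by
    refine le_antisymm (nonpos_of_exp_growth hK0 fun A hA => ?_) hb
    obtain ⟨Q, hQ⟩ := exists_norm_laplace_radial_le (m := m) hB hA
    refine ⟨Q, fun x hx => le_trans ?_ (hQ x hx)⟩
    have h1 : cdot (Pi.single 0 ((√x : ℝ) : ℂ) : Fin (m + 1) → ℂ) (Pi.single 0 ((√x : ℝ) : ℂ)) =
        (x : ℂ) := by
      rw [cdot, Finset.sum_eq_single 0]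
      · rw [Pi.single_eq_same, ← Complex.ofReal_mul, Real.mul_self_sqrt hx]
      · simp +contextual
      · simp
    rw [hlap, h1, ← ofReal_laguerreFun K b hlams x, Complex.norm_real]
    exact (mul_exp_le_laguerreFun hK0.le hlam hlams hx).trans (Real.le_norm_self _)
  refine ⟨K, lam, hK0, hlam, hlams, fun z => ?_⟩
  rw [hlap, hb0]
  simp

end LeeYang

/-- **Proposition (Lee–Yang property of the measure `f(σ²)e^{-g(σ²)}dσ`).**
If `f` is a Laguerre entire function of the first kind (without zero at the origin),
`g` is positive on `[0,∞)` with derivative `g'` of Laguerre form, `g'` not constant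
equal to `C_g` (i.e. not all of `β, δ_j` vanish), and the relevant integrability holds,
then the Laplace transform of `f(σ²)e^{-g(σ²)}dσ` on `ℝ^D` has the Lee–Yang product
form `C ∏_j (1 + λ_j z²)`. -/
theorem leeYang_of_laguerre_density
    (D : ℕ) (hD : 0 < D)
    (f : ℂ → ℂ) (Cf α : ℝ) (γ : ℕ → ℝ)
    (hCf : 0 < Cf) (hα : 0 ≤ α) (hγ : ∀ j, 0 ≤ γ j) (hγs : Summable γ)
    (hf : ∀ ζ : ℂ, f ζ = (Cf : ℂ) * Complex.exp ((α : ℂ) * ζ) *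
      ∏' j, (1 + (γ j : ℂ) * ζ))
    (g : ℝ → ℝ) (hg : ∀ s : ℝ, 0 ≤ s → 0 < g s)
    (Cg β : ℝ) (δ : ℕ → ℝ)
    (hCg : 0 < Cg) (hβ : 0 ≤ β) (hδ : ∀ j, 0 ≤ δ j) (hδs : Summable δ)
    (hg' : ∀ s : ℝ, 0 ≤ s →
      HasDerivWithinAt g (Cg * Real.exp (β * s) * ∏' j, (1 + δ j * s)) (Set.Ici 0) s)
    (hnontriv : β ≠ 0 ∨ ∃ j, δ j ≠ 0)
    (hint : ∀ a : ℝ, 0 < a →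
      Integrable (fun σ : Fin D → ℝ =>
        Complex.exp ((a * rdot σ σ : ℝ) : ℂ) * f ((rdot σ σ : ℝ) : ℂ) *
          Complex.exp (-((g (rdot σ σ) : ℝ) : ℂ)))) :
    ∃ (C : ℝ) (lam : ℕ → ℝ), 0 < C ∧ (∀ j, 0 ≤ lam j) ∧ Summable lam ∧
      ∀ z : Fin D → ℂ,
        (∫ σ : Fin D → ℝ,
          Complex.exp (cpair z σ) * f ((rdot σ σ : ℝ) : ℂ) *
            Complex.exp (-((g (rdot σ σ) : ℝ) : ℂ)))
          = (C : ℂ) * ∏' j, (1 + (lam j : ℂ) * cdot z z) := by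
  obtain ⟨m, rfl⟩ := Nat.exists_eq_succ_of_ne_zero hD.ne'
  have hpos : ∀ r : ℝ, 0 < LeeYang.laguerreFun Cf α γ (r ^ 2) * Real.exp (-(g (r ^ 2) - g 0)) :=
    fun r => mul_pos (hCf.trans_le (LeeYang.le_laguerreFun hCf.le hα hγ hγs (sq_nonneg r)))
      (Real.exp_pos _)
  obtain ⟨K, lam, hK, hlam, hlams, h⟩ := LeeYang.exists_laplace_radial_eq_tprod (m := m)
    (LeeYang.measurable_density Cf α hγs hCg hβ hδ hδs hg') hpos
    (fun A => by
      obtain ⟨B, hB⟩ := LeeYang.exists_density_le hCf hα hγ hγs hCg hβ hδ hδs hnontriv hg' A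
      exact ⟨B, fun r _ => hB (r ^ 2) (sq_nonneg r)⟩)
    (LeeYang.density_moment_mem hCf hα hγ hγs hCg hβ hδ hδs hnontriv hg' m)
  refine ⟨K * Real.exp (-g 0), lam, mul_pos hK (Real.exp_pos _), hlam, hlams, fun z => ?_⟩
  have key : ∀ σ : Fin (m + 1) → ℝ,
      Complex.exp (cpair z σ) * f ((rdot σ σ : ℝ) : ℂ) *
          Complex.exp (-((g (rdot σ σ) : ℝ) : ℂ)) =
        Complex.exp (cpair z σ) *
          ((LeeYang.laguerreFun Cf α γ (√(rdot σ σ) ^ 2) *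
            Real.exp (-(g (√(rdot σ σ) ^ 2) - g 0)) : ℝ) : ℂ) * (Real.exp (-g 0) : ℂ) := by
    intro σ
    have hexp : Real.exp (-g (rdot σ σ)) =
        Real.exp (-(g (rdot σ σ) - g 0)) * Real.exp (-g 0) := by
      rw [← Real.exp_add]
      congr 1
      ring
    rw [Real.sq_sqrt (LeeYang.rdot_self_nonneg σ), hf, ← LeeYang.ofReal_laguerreFun Cf α hγs,
      ← Complex.ofReal_neg (g _), ← Complex.ofReal_exp, hexp]
    push_cast
    ring
  rw [integral_congr_ae (Filter.Eventually.of_forall key), integral_mul_const, h]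
  push_cast
  ring
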